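/- arXiv:1611.08488 — 3 statements merged into one kernel-verified Lean document; each statement's English description precedes it below -/
import Mathlib

section
/- Let d ≥ 1 and let T : 𝕋^d → 𝕋^d be a positively expansive continuous map of the d-dimensional torus 𝕋^d = ℝ^d/ℤ^d. Then Obs(T) = 2: there exists a continuous f : 𝕋^d → ℝ^2 observing T, but no continuous f : 𝕋^d → ℝ observes T. -/
open Set Topology Function

/-- The observability number of `T : X → X`: the minimal `m ≥ 1` for which there exists a
continuous `f : X → ℝ^m` observing `T` (`⊤` if no such `m` exists). -/
noncomputable def obsNum {X : Type*} [TopologicalSpace X] (T : X → X) : ℕ∞ :=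
  sInf {m : ℕ∞ | ∃ k : ℕ, m = (k : ℕ∞) ∧ 1 ≤ k ∧
    ∃ f : C(X, EuclideanSpace ℝ (Fin k)),
      ∀ x y : X, x ≠ y → ∃ n : ℕ, f (T^[n] x) ≠ f (T^[n] y)}

/-- The projection `ℝ^d → 𝕋^d`. -/
def torusMk {d : ℕ} : (Fin d → ℝ) →+ (Fin d → UnitAddCircle) where
  toFun v i := (v i : UnitAddCircle)
  map_zero' := rfl
  map_add' _ _ := rfl

/-- The inclusion of the lattice `ℤ^d` in `ℝ^d`. -/
def intVec {d : ℕ} : (Fin d → ℤ) →+ (Fin d → ℝ) where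
  toFun m i := m i
  map_zero' := by ext; simp
  map_add' _ _ := by ext; simp

section Torus

variable {d : ℕ}

@[simp] lemma torusMk_apply (v : Fin d → ℝ) (i : Fin d) :
    torusMk v i = (v i : UnitAddCircle) := rfl

@[simp] lemma intVec_apply (m : Fin d → ℤ) (i : Fin d) : intVec m i = (m i : ℝ) := rfl

lemma intVec_injective : Injective (intVec (d := d)) := fun m n h => by
  ext i
  simpa using congrFun h i

lemma torusMk_eq_zero_iff {v : Fin d → ℝ} : torusMk v = 0 ↔ ∃ m, v = intVec m := by
  constructor
  · intro h
    have h' : ∀ i, ∃ n : ℤ, (n : ℝ) = v i := fun i => by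
      have := congrFun h i
      simp only [torusMk_apply, Pi.zero_apply, AddCircle.coe_eq_zero_iff] at this
      simpa using this
    choose n hn using h'
    exact ⟨n, funext fun i => (hn i).symm⟩
  · rintro ⟨m, rfl⟩
    ext i
    simp only [torusMk_apply, Pi.zero_apply, AddCircle.coe_eq_zero_iff, intVec_apply]
    exact ⟨m i, by simp⟩

@[simp] lemma torusMk_intVec (m : Fin d → ℤ) : torusMk (intVec m) = 0 :=
  torusMk_eq_zero_iff.2 ⟨m, rfl⟩

lemma torusMk_eq_iff {v w : Fin d → ℝ} : torusMk v = torusMk w ↔ ∃ m, v = w + intVec m := by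
  rw [← sub_eq_zero, ← map_sub, torusMk_eq_zero_iff]
  simp only [sub_eq_iff_eq_add']

lemma isOpenQuotientMap_torusMk : IsOpenQuotientMap (torusMk (d := d)) :=
  IsOpenQuotientMap.piMap (f := fun (_ : Fin d) (x : ℝ) => (x : UnitAddCircle))
    fun _ => QuotientAddGroup.isOpenQuotientMap_mk

lemma continuous_torusMk : Continuous (torusMk (d := d)) := isOpenQuotientMap_torusMk.continuous

lemma torusMk_surjective : Surjective (torusMk (d := d)) := isOpenQuotientMap_torusMk.surjective

lemma exists_sub_intVec_mem_Icc (v : Fin d → ℝ) : ∃ m, v - intVec m ∈ Icc (0 : Fin d → ℝ) 1 :=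
  ⟨fun i => ⌊v i⌋, fun i => by simp, fun i => by simpa using (Int.fract_lt_one (v i)).le⟩

lemma dist_torusMk_le (v w : Fin d → ℝ) : dist (torusMk v) (torusMk w) ≤ ‖v - w‖ := by
  rw [dist_eq_norm, ← map_sub, pi_norm_le_iff_of_nonneg (norm_nonneg _)]
  intro i
  refine le_trans ?_ (norm_le_pi_norm (v - w) i)
  have h := round_le (v i - w i) 0
  rw [Int.cast_zero, sub_zero] at h
  change ‖((v i - w i : ℝ) : UnitAddCircle)‖ ≤ |v i - w i|
  rwa [UnitAddCircle.norm_eq]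

lemma norm_sub_le_dist_torusMk {v w : Fin d → ℝ} (h : ‖v - w‖ ≤ 1 / 2) :
    ‖v - w‖ ≤ dist (torusMk v) (torusMk w) := by
  rw [dist_eq_norm, ← map_sub, pi_norm_le_iff_of_nonneg (norm_nonneg _)]
  intro i
  have h1 : |(v - w) i| ≤ 1 / 2 := (norm_le_pi_norm (v - w) i).trans h
  have h2 := (AddCircle.norm_coe_eq_abs_iff (1 : ℝ) (x := (v - w) i) one_ne_zero).2
    (by simpa using h1)
  rw [Real.norm_eq_abs, ← h2]
  exact norm_le_pi_norm (torusMk (v - w)) i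

lemma norm_intVec_ge {m : Fin d → ℤ} (hm : m ≠ 0) : 1 ≤ ‖intVec m‖ := by
  obtain ⟨i, hi⟩ := Function.ne_iff.1 hm
  refine le_trans ?_ (norm_le_pi_norm (intVec m) i)
  rw [intVec_apply, Real.norm_eq_abs]
  exact_mod_cast Int.one_le_abs hi

/-- A continuous function on `ℝ^d` that is constant along `ℤ^d` descends to the torus. -/
lemma exists_descend {Y : Type*} [TopologicalSpace Y] {u : (Fin d → ℝ) → Y} (hu : Continuous u)
    (hper : ∀ v m, u (v + intVec m) = u v) :
    ∃ f : C(Fin d → UnitAddCircle, Y), ∀ v, f (torusMk v) = u v := by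
  have hfac : ∀ v w : Fin d → ℝ, torusMk v = torusMk w → u v = u w := by
    intro v w h
    obtain ⟨m, rfl⟩ := torusMk_eq_iff.1 h
    exact hper w m
  have hq : IsQuotientMap (torusMk (d := d)) := isOpenQuotientMap_torusMk.isQuotientMap
  refine ⟨hq.lift (f := ⟨torusMk, continuous_torusMk⟩) ⟨u, hu⟩ (fun v w h => hfac v w h),
    fun v => ?_⟩
  exact congrArg (fun F : C(Fin d → ℝ, Y) => F v)
    (hq.lift_comp (f := ⟨torusMk, continuous_torusMk⟩) ⟨u, hu⟩ (fun v w h => hfac v w h))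

/-- Smooth functions are uniformly dense in the continuous functions on the torus. -/
lemma exists_contDiff_near (f : C(Fin d → UnitAddCircle, ℂ)) {ε : ℝ} (hε : 0 < ε) :
    ∃ g : C(Fin d → UnitAddCircle, ℂ), ContDiff ℝ 1 (fun v => g (torusMk v)) ∧ ‖g - f‖ < ε := by
  have hf : f ∈ (Submodule.span ℂ (range <| UnitAddTorus.mFourier (d := Fin d))).topologicalClosure :=
      by
    rw [UnitAddTorus.span_mFourier_closure_eq_top]; trivial
  rw [← SetLike.mem_coe, Submodule.topologicalClosure_coe, Metric.mem_closure_iff] at hf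
  obtain ⟨g, hg, hfg⟩ := hf ε hε
  refine ⟨g, ?_, by rwa [← dist_eq_norm, dist_comm]⟩
  clear hfg
  induction hg using Submodule.span_induction with
  | mem g hg =>
    obtain ⟨n, rfl⟩ := hg
    simp only [UnitAddTorus.mFourier, ContinuousMap.coe_mk, torusMk_apply, fourier_coe_apply]
    have hc : ∀ i : Fin d, ContDiff ℝ 1 fun v : Fin d → ℝ => ((v i : ℝ) : ℂ) := fun i =>
      Complex.ofRealCLM.contDiff.comp (contDiff_apply ℝ ℝ i)
    refine contDiff_prod fun i _ => ContDiff.cexp ?_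
    exact (contDiff_const.mul (hc i)).div_const _
  | zero => simpa using contDiff_const
  | add g h _ _ hg hh => simpa using hg.add hh
  | smul c g _ hg => simpa using contDiff_const.mul hg

end Torus

section Degree

open MeasureTheory

variable {d : ℕ}

/-- The half-open unit cube. -/
def unitCube (d : ℕ) : Set (Fin d → ℝ) := Set.univ.pi fun _ => Ico (0 : ℝ) 1

lemma measurableSet_unitCube : MeasurableSet (unitCube d) :=
  MeasurableSet.univ_pi fun _ => measurableSet_Ico

lemma volume_unitCube : volume (unitCube d) = 1 := by
  simp [unitCube, Real.volume_pi_Ico]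

lemma unitCube_subset_Icc : unitCube d ⊆ Icc 0 1 := fun _ hx =>
  ⟨fun i => (hx i trivial).1, fun i => (hx i trivial).2.le⟩

lemma existsUnique_add_mem_unitCube (x : Fin d → ℝ) : ∃! m, intVec m + x ∈ unitCube d := by
  refine ⟨fun i => -⌊x i⌋, fun i _ => ?_, fun m hm => funext fun i => ?_⟩
  · simp only [Pi.add_apply, intVec_apply, Int.cast_neg, mem_Ico]
    constructor <;> linarith [Int.floor_le (x i), Int.lt_floor_add_one (x i)]
  · have h := hm i trivial
    simp only [Pi.add_apply, intVec_apply, mem_Ico] at h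
    have : ⌊x i⌋ = -m i := by
      rw [Int.floor_eq_iff]
      push_cast
      constructor <;> linarith
    rw [this, neg_neg]

/-- The image of the unit cube under an equivariant homeomorphism has unit volume. -/
lemma volume_image_unitCube (g : (Fin d → ℝ) ≃ₜ (Fin d → ℝ))
    (hg : ∀ x m, g (x + intVec m) = g x + intVec m) : volume (g '' unitCube d) = 1 := by
  have key : ∀ s : Set (Fin d → ℝ), MeasurableSet s →
      (∀ x, ∃! m, intVec m + x ∈ s) →
      IsAddFundamentalDomain (intVec (d := d)).range s volume := by
    intro s hs hx
    refine IsAddFundamentalDomain.mk' hs.nullMeasurableSet fun x => ?_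
    obtain ⟨m, hm, huniq⟩ := hx x
    refine ⟨⟨intVec m, m, rfl⟩, hm, ?_⟩
    rintro ⟨_, n, rfl⟩ hn
    exact Subtype.ext (congrArg intVec (huniq n hn))
  have h1 := key _ measurableSet_unitCube existsUnique_add_mem_unitCube
  have h2 := key (g '' unitCube d)
      (g.measurableEmbedding.measurableSet_image.2 measurableSet_unitCube) <| by
    intro y
    obtain ⟨x, rfl⟩ := g.surjective y
    have : ∀ m, intVec m + g x ∈ g '' unitCube d ↔ intVec m + x ∈ unitCube d := fun m => by
      rw [add_comm, ← hg, add_comm x, g.injective.mem_set_image]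
    simpa only [this] using existsUnique_add_mem_unitCube x
  have : Countable (intVec (d := d)).range := by
    exact (Set.countable_range (intVec (d := d))).to_subtype
  rw [← h1.measure_eq h2, volume_unitCube]

lemma exists_norm_fderiv_le {u : (Fin d → ℝ) → (Fin d → ℝ)} (hu : ContDiff ℝ 1 u)
    (hper : ∀ x m, u (x + intVec m) = u x) : ∃ K : ℝ, 0 < K ∧ ∀ x, ‖fderiv ℝ u x‖ ≤ K := by
  have hc : Continuous (fderiv ℝ u) := hu.continuous_fderiv one_ne_zero
  obtain ⟨K, hK⟩ := (isCompact_Icc (a := (0 : Fin d → ℝ)) (b := 1)).exists_bound_of_continuousOn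
    hc.continuousOn
  refine ⟨max K 1, by positivity, fun x => ?_⟩
  obtain ⟨m, hm⟩ := exists_sub_intVec_mem_Icc x
  have h : fderiv ℝ u x = fderiv ℝ u (x - intVec m) := by
    have h1 := fderiv_comp_add_right (𝕜 := ℝ) (f := u) (x := x - intVec m) (intVec m)
    simp only [hper, sub_add_cancel] at h1
    exact h1.symm
  rw [h]
  exact (hK _ hm).trans (le_max_left _ _)

/-- For a small periodic perturbation of the identity the Jacobian determinant has mean one. -/
lemma integral_det_one_add_smul {u : (Fin d → ℝ) → (Fin d → ℝ)} (hu : ContDiff ℝ 1 u)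
    (hper : ∀ x m, u (x + intVec m) = u x) {K : ℝ} (hK : ∀ x, ‖fderiv ℝ u x‖ ≤ K)
    {t : ℝ} (ht : 0 ≤ t) (htK : t * K < 1) :
    ∫ x in unitCube d, (1 + t • fderiv ℝ u x).det = 1 := by
  have hK0 : 0 ≤ K := (norm_nonneg _).trans (hK 0)
  set g : (Fin d → ℝ) → (Fin d → ℝ) := fun x => x + t • u x with hgdef
  have hlip : LipschitzWith ⟨K, hK0⟩ u :=
    lipschitzWith_of_nnnorm_fderiv_le (hu.differentiable one_ne_zero) fun x => hK x
  have happ : ApproximatesLinearOn g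
      ((ContinuousLinearEquiv.refl ℝ (Fin d → ℝ) : (Fin d → ℝ) ≃L[ℝ] (Fin d → ℝ)) :
        (Fin d → ℝ) →L[ℝ] (Fin d → ℝ)) univ ⟨t * K, by positivity⟩ := by
    intro x _ y _
    have h : g x - g y - (x - y) = t • (u x - u y) := by
      simp only [hgdef, smul_sub]; abel
    change ‖g x - g y - (x - y)‖ ≤ t * K * ‖x - y‖
    rw [h, norm_smul, Real.norm_of_nonneg ht, ← dist_eq_norm, ← dist_eq_norm]
    have := hlip.dist_le_mul x y
    rw [mul_assoc]
    exact mul_le_mul_of_nonneg_left this ht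
  have hc : Subsingleton (Fin d → ℝ) ∨ (⟨t * K, by positivity⟩ : NNReal) <
      ‖((ContinuousLinearEquiv.refl ℝ (Fin d → ℝ)).symm :
        (Fin d → ℝ) →L[ℝ] (Fin d → ℝ))‖₊⁻¹ := by
    rcases subsingleton_or_nontrivial (Fin d → ℝ) with h | h
    · exact Or.inl h
    · right
      have : ‖((ContinuousLinearEquiv.refl ℝ (Fin d → ℝ)).symm :
        (Fin d → ℝ) →L[ℝ] (Fin d → ℝ))‖₊ = 1 := by
        ext; simp
      rw [this, inv_one]
      exact htK
  have hvol := volume_image_unitCube (happ.toHomeomorph g hc) (fun x m => by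
    change x + intVec m + t • u (x + intVec m) = x + t • u x + intVec m
    rw [hper]; abel)
  have hder : ∀ x, HasFDerivAt g (1 + t • fderiv ℝ u x) x := fun x =>
    (hasFDerivAt_id x).add ((hu.differentiable one_ne_zero x).hasFDerivAt.const_smul t)
  have hcv := lintegral_abs_det_fderiv_eq_addHaar_image volume (measurableSet_unitCube (d := d))
    (fun x _ => (hder x).hasFDerivWithinAt) (happ.toHomeomorph g hc).injective.injOn
  have hpos : ∀ x, 0 < (1 + t • fderiv ℝ u x).det := by
    intro x
    have hne : ∀ s ∈ Icc (0 : ℝ) 1, (1 + s • (t • fderiv ℝ u x)).det ≠ 0 := by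
      intro s hs
      have hlt : ‖-(s • (t • fderiv ℝ u x))‖ < 1 := by
        rw [norm_neg, norm_smul, norm_smul, Real.norm_of_nonneg ht, Real.norm_of_nonneg hs.1]
        have h1 : t * ‖fderiv ℝ u x‖ ≤ t * K := mul_le_mul_of_nonneg_left (hK x) ht
        have h2 : 0 ≤ t * ‖fderiv ℝ u x‖ := by positivity
        nlinarith [hs.2]
      have hu := isUnit_one_sub_of_norm_lt_one hlt
      rw [sub_neg_eq_add] at hu
      rw [ContinuousLinearMap.det]
      have h3 : IsUnit ((1 + s • (t • fderiv ℝ u x) : (Fin d → ℝ) →L[ℝ] (Fin d → ℝ)) :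
          (Fin d → ℝ) →ₗ[ℝ] (Fin d → ℝ)) :=
        hu.map (ContinuousLinearMap.toLinearMapRingHom (R₁ := ℝ) (M₁ := Fin d → ℝ))
      exact ((LinearMap.isUnit_iff_isUnit_det _).1 h3).ne_zero
    by_contra hneg
    have hcont : ContinuousOn (fun s : ℝ => (1 + s • (t • fderiv ℝ u x)).det) (Icc 0 1) :=
      (ContinuousLinearMap.continuous_det.comp (by fun_prop)).continuousOn
    have hmem : (0 : ℝ) ∈ Icc (1 + (1 : ℝ) • (t • fderiv ℝ u x)).det
        (1 + (0 : ℝ) • (t • fderiv ℝ u x)).det := by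
      refine ⟨by simpa using hneg, ?_⟩
      rw [zero_smul, add_zero]
      simp [ContinuousLinearMap.det]
    obtain ⟨s, hs, hs0⟩ := intermediate_value_Icc' zero_le_one hcont hmem
    exact hne s hs hs0
  rw [integral_eq_lintegral_of_nonneg_ae (Filter.Eventually.of_forall fun x => (hpos x).le)]
  · simp_rw [abs_of_pos (hpos _)] at hcv
    rw [hcv]
    change (volume ((happ.toHomeomorph g hc) '' unitCube d)).toReal = 1
    rw [hvol, ENNReal.toReal_one]
  · have : Continuous fun x => (1 + t • fderiv ℝ u x).det :=
      ContinuousLinearMap.continuous_det.comp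
        (continuous_const.add ((hu.continuous_fderiv one_ne_zero).const_smul t))
    exact this.aestronglyMeasurable

/-- A periodic perturbation of the identity has Jacobian determinant of mean one. -/
lemma integral_det_one_add {u : (Fin d → ℝ) → (Fin d → ℝ)} (hu : ContDiff ℝ 1 u)
    (hper : ∀ x m, u (x + intVec m) = u x) :
    ∫ x in unitCube d, (1 + fderiv ℝ u x).det = 1 := by
  obtain ⟨K, hK0, hK⟩ := exists_norm_fderiv_le hu hper
  set s : Finset ℕ := Finset.range (d + 1) with hs
  set v : ℕ → ℝ := fun k => k / ((d + 1) * K) with hv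
  have hvinj : Set.InjOn v s := by
    intro a _ b _ hab
    have : ((d : ℝ) + 1) * K ≠ 0 := by positivity
    simp only [hv] at hab
    exact_mod_cast (div_left_inj' this).1 hab
  set c : ℕ → ℝ := fun k => (Lagrange.basis s v k).eval 1 with hcdef
  have hsum : ∑ k ∈ s, c k = 1 := by
    have := congrArg (Polynomial.eval 1) (Lagrange.sum_basis hvinj ⟨0, by simp [hs]⟩)
    simpa [Polynomial.eval_finsetSum] using this
  have hdet : ∀ N : (Fin d → ℝ) →L[ℝ] (Fin d → ℝ),
      (1 + N).det = ∑ k ∈ s, c k * (1 + v k • N).det := by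
    intro N
    set M := LinearMap.toMatrix' (N : (Fin d → ℝ) →ₗ[ℝ] (Fin d → ℝ)) with hM
    set q : Polynomial ℝ := ((Polynomial.X : Polynomial ℝ) • M.map Polynomial.C +
      (1 : Matrix (Fin d) (Fin d) ℝ).map Polynomial.C).det with hq
    have heval : ∀ t : ℝ, (1 + t • N).det = q.eval t := by
      intro t
      rw [hq, ← Polynomial.coe_evalRingHom, RingHom.map_det, ContinuousLinearMap.det,
        ← LinearMap.det_toMatrix']
      congr 1
      ext i j
      simp [hM, LinearMap.toMatrix'_apply, Matrix.one_apply, Pi.single_apply, add_comm]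
      split_ifs <;> simp [mul_comm]
    have hdeg : q.degree < s.card := by
      rw [hs, Finset.card_range]
      refine lt_of_le_of_lt Polynomial.degree_le_natDegree ?_
      have := Polynomial.natDegree_det_X_add_C_le M 1
      rw [Fintype.card_fin] at this
      exact_mod_cast Nat.lt_succ_of_le this
    have hinterp := congrArg (Polynomial.eval 1) (Lagrange.eq_interpolate hvinj hdeg)
    rw [Lagrange.interpolate_apply, Polynomial.eval_finsetSum] at hinterp
    rw [← one_smul ℝ N, heval, hinterp]
    refine Finset.sum_congr rfl fun k _ => ?_
    rw [one_smul, heval, Polynomial.eval_mul, Polynomial.eval_C, mul_comm]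
  rw [funext fun x => hdet (fderiv ℝ u x)]
  rw [integral_finsetSum]
  · rw [← hsum]
    refine Finset.sum_congr rfl fun k hk => ?_
    rw [integral_const_mul, integral_det_one_add_smul hu hper hK (by positivity), mul_one]
    have : (k : ℝ) < d + 1 := by exact_mod_cast Finset.mem_range.1 hk
    simp only [hv]
    rw [div_mul_eq_mul_div, div_lt_one (by positivity)]
    gcongr
  · intro k _
    have hcont : Continuous fun x => v k • fderiv ℝ u x := by
      have := hu.continuous_fderiv one_ne_zero
      fun_prop
    have : Continuous fun x => c k * (1 + v k • fderiv ℝ u x).det :=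
      continuous_const.mul (ContinuousLinearMap.continuous_det.comp (continuous_const.add hcont))
    exact (this.continuousOn.integrableOn_compact isCompact_Icc).mono_set unitCube_subset_Icc
end Degree

section Surjectivity

open MeasureTheory intervalIntegral

variable {d : ℕ}

/-- A degree-one circle map (lifted to `ℝ`) that is locally constant away from a small
neighbourhood of the integers. -/
lemma exists_collapse {ε : ℝ} (hε : 0 < ε) : ∃ η : ℝ → ℝ, ContDiff ℝ 1 η ∧
    (∀ t (n : ℤ), η (t + n) = η t + n) ∧
    ∀ t, Real.cos (2 * Real.pi * t) ≤ 1 - ε → HasDerivAt η 0 t := by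
  set κ : ℝ → ℝ := fun t => max 0 (Real.cos (2 * Real.pi * t) - (1 - ε)) with hκ
  have hκc : Continuous κ := by fun_prop
  have hκ0 : ∀ t, 0 ≤ κ t := fun t => le_max_left _ _
  have hper : Function.Periodic κ 1 := fun t => by
    simp only [hκ]
    rw [mul_add, mul_one, Real.cos_add_two_pi]
  set I : ℝ := ∫ s in (0 : ℝ)..1, κ s with hI
  have hIpos : 0 < I := by
    refine integral_pos one_pos hκc.continuousOn (fun t _ => hκ0 t)
      ⟨0, by simp, lt_max_of_lt_right ?_⟩
    simpa using hε
  set η : ℝ → ℝ := fun t => (∫ s in (0 : ℝ)..t, κ s) / I with hη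
  have hder : ∀ t, HasDerivAt η (κ t / I) t := fun t =>
    (hκc.integral_hasStrictDerivAt 0 t).hasDerivAt.div_const I
  refine ⟨η, ?_, ?_, ?_⟩
  · rw [contDiff_one_iff_deriv]
    refine ⟨fun t => (hder t).differentiableAt, ?_⟩
    rw [funext fun t => (hder t).deriv]
    exact hκc.div_const I
  · intro t n
    have h1 : ∀ t, η (t + 1) = η t + 1 := fun t => by
      simp only [hη]
      rw [← integral_add_adjacent_intervals (hκc.intervalIntegrable 0 t)
        (hκc.intervalIntegrable t (t + 1)), hper.intervalIntegral_add_eq t 0, zero_add, add_div,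
        div_self hIpos.ne']
    induction n using Int.induction_on with
    | zero => simp
    | succ n ih => push_cast at ih ⊢; rw [← add_assoc, h1, ih, add_assoc]
    | pred n ih =>
      have := h1 (t + ((-n - 1 : ℤ) : ℝ))
      push_cast at ih this ⊢
      have e : t + (-(n : ℝ) - 1) + 1 = t + -n := by ring
      rw [e, ih] at this
      linarith
  · intro t ht
    have h0 : κ t = 0 := max_eq_left (by linarith)
    simpa [h0] using hder t

/-- A `C¹` map of the form identity plus periodic cannot avoid a neighbourhood of `ℤ^d`. -/
lemma not_avoids_lattice {u : (Fin d → ℝ) → (Fin d → ℝ)} (hu : ContDiff ℝ 1 u)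
    (hper : ∀ x m, u (x + intVec m) = u x) {ε : ℝ} (hε : 0 < ε)
    (h : ∀ x, ∃ i, Real.cos (2 * Real.pi * (x i + u x i)) ≤ 1 - ε) : False := by
  obtain ⟨η, hη, hηper, hη0⟩ := exists_collapse hε
  set w : (Fin d → ℝ) → (Fin d → ℝ) := fun x i => η (x i + u x i) - x i with hw
  have hui : ∀ i, ContDiff ℝ 1 fun x => u x i := fun i => contDiff_pi.1 hu i
  have hwc : ContDiff ℝ 1 w := contDiff_pi.2 fun i =>
    (hη.comp ((contDiff_apply ℝ ℝ i).add (hui i))).sub (contDiff_apply ℝ ℝ i)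
  have hwper : ∀ x m, w (x + intVec m) = w x := fun x m => funext fun i => by
    simp only [hw, hper, Pi.add_apply, intVec_apply]
    rw [add_right_comm, hηper]; ring
  have hint := integral_det_one_add hwc hwper
  have hzero : ∀ x, (1 + fderiv ℝ w x).det = 0 := by
    intro x
    obtain ⟨i, hi⟩ := h x
    have hrow : (ContinuousLinearMap.proj (R := ℝ) (φ := fun _ : Fin d => ℝ) i).comp
        (1 + fderiv ℝ w x) = 0 := by
      have h1 : HasFDerivAt (fun y => η (y i + u y i))
          ((ContinuousLinearMap.proj (R := ℝ) (φ := fun _ : Fin d => ℝ) i).comp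
            (1 + fderiv ℝ w x)) x := by
        have h2 : HasFDerivAt (fun y => y + w y) (1 + fderiv ℝ w x) x :=
          (hasFDerivAt_id x).add (hwc.differentiable one_ne_zero x).hasFDerivAt
        have h3 := (ContinuousLinearMap.proj (R := ℝ) (φ := fun _ : Fin d => ℝ) i).hasFDerivAt.comp
          x h2
        refine h3.congr_of_eventuallyEq (Filter.Eventually.of_forall fun y => ?_)
        simp [hw]
      have h4 : HasFDerivAt (fun y : Fin d → ℝ => y i + u y i)
          (fderiv ℝ (fun y : Fin d → ℝ => y i + u y i) x) x :=
        (((contDiff_apply ℝ ℝ i).add (hui i)).differentiable one_ne_zero x).hasFDerivAt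
      have h5 := (hη0 _ hi).comp_hasFDerivAt x h4
      rw [zero_smul] at h5
      exact h1.unique h5
    rw [ContinuousLinearMap.det]
    by_contra hne
    have hunit := (LinearMap.isUnit_iff_isUnit_det _).2 (isUnit_iff_ne_zero.2 hne)
    rw [Module.End.isUnit_iff] at hunit
    obtain ⟨y, hy⟩ := hunit.surjective (Pi.single i 1)
    have h1 := DFunLike.congr_fun hrow y
    have h2 := congrFun hy i
    simp only [ContinuousLinearMap.comp_apply, ContinuousLinearMap.proj_apply,
      _root_.zero_apply] at h1
    rw [Pi.single_eq_same] at h2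
    exact one_ne_zero (h2.symm.trans h1)
  simp [hzero] at hint

lemma exists_contDiff_periodic_near {u : (Fin d → ℝ) → (Fin d → ℝ)} (hu : Continuous u)
    (hper : ∀ x m, u (x + intVec m) = u x) {ε : ℝ} (hε : 0 < ε) :
    ∃ v : (Fin d → ℝ) → (Fin d → ℝ), ContDiff ℝ 1 v ∧ (∀ x m, v (x + intVec m) = v x) ∧
      ∀ x i, |v x i - u x i| ≤ ε := by
  have h : ∀ i, ∃ g : C(Fin d → UnitAddCircle, ℂ), ContDiff ℝ 1 (fun v => g (torusMk v)) ∧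
      ∀ x, ‖g (torusMk x) - u x i‖ ≤ ε := by
    intro i
    obtain ⟨f, hf⟩ := exists_descend (u := fun x => ((u x i : ℝ) : ℂ)) (by fun_prop)
      (fun x m => by rw [hper])
    obtain ⟨g, hg, hgf⟩ := exists_contDiff_near f hε
    refine ⟨g, hg, fun x => ?_⟩
    rw [← hf x]
    exact ((g - f).norm_coe_le_norm (torusMk x)).trans hgf.le
  choose g hg hgu using h
  refine ⟨fun x i => (g i (torusMk x)).re, contDiff_pi.2 fun i =>
    Complex.reCLM.contDiff.comp (hg i), fun x m => ?_, fun x i => ?_⟩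
  · simp
  · have := (Complex.abs_re_le_norm _).trans (hgu i x)
    simpa using this

/-- A continuous map of `ℝ^d` of the form identity plus periodic is surjective. -/
theorem surjective_id_add_periodic {u : (Fin d → ℝ) → (Fin d → ℝ)} (hu : Continuous u)
    (hper : ∀ x m, u (x + intVec m) = u x) : Surjective fun x => x + u x := by
  intro y
  by_contra hy
  push Not at hy
  set c : ℝ → ℝ := fun t => Real.cos (2 * Real.pi * t) with hc
  set F : (Fin d → ℝ) → ℝ := fun x => ∑ i, (1 - c (x i + u x i - y i)) with hF
  have hFc : Continuous F := by simp only [hF, hc]; fun_prop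
  have hnonneg : ∀ t, 0 ≤ 1 - c t := fun t => by
    simp only [hc]; linarith [Real.cos_le_one (2 * Real.pi * t)]
  have hcint : ∀ t (n : ℤ), c (t + n) = c t := fun t n => by
    simp only [hc]
    rw [mul_add, mul_comm (2 * Real.pi) (n : ℝ), Real.cos_add_int_mul_two_pi]
  have hFpos : ∀ x, 0 < F x := by
    intro x
    refine (Finset.sum_nonneg fun i _ => hnonneg _).lt_of_ne fun h0 => ?_
    have h1 := (Finset.sum_eq_zero_iff_of_nonneg fun i _ => hnonneg _).1 h0.symm
    have h2 : ∀ i, ∃ n : ℤ, (n : ℝ) = x i + u x i - y i := fun i => by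
      have h3 : Real.cos (2 * Real.pi * (x i + u x i - y i)) = 1 := by
        have := h1 i (Finset.mem_univ i); simp only [hc] at this; linarith
      obtain ⟨n, hn⟩ := (Real.cos_eq_one_iff _).1 h3
      refine ⟨n, ?_⟩
      have := Real.pi_pos
      field_simp at hn
      linarith
    choose n hn using h2
    refine hy (x - intVec n) ?_
    have h4 := hper (x - intVec n) n
    rw [sub_add_cancel] at h4
    change x - intVec n + u (x - intVec n) = y
    rw [← h4]
    ext i
    simp only [Pi.add_apply, Pi.sub_apply, intVec_apply, hn]
    ring
  have hFper : ∀ x m, F (x + intVec m) = F x := fun x m => by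
    simp only [hF]
    refine Finset.sum_congr rfl fun i _ => ?_
    rw [hper, Pi.add_apply, intVec_apply, add_right_comm, add_sub_right_comm, hcint]
  obtain ⟨x₀, -, hx₀⟩ := (isCompact_Icc (a := (0 : Fin d → ℝ)) (b := 1)).exists_isMinOn
    ⟨0, by simp⟩ hFc.continuousOn
  have hFmin : ∀ x, F x₀ ≤ F x := fun x => by
    obtain ⟨m, hm⟩ := exists_sub_intVec_mem_Icc x
    have := hx₀ hm
    rw [← sub_add_cancel x (intVec m), hFper]
    exact this
  set ε := F x₀ / (2 * (d + 1)) with hε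
  have hεpos : 0 < ε := by have := hFpos x₀; positivity
  obtain ⟨v, hv, hvper, hvu⟩ := exists_contDiff_periodic_near (u := fun x => u x - y)
    (by fun_prop) (fun x m => by simp only [hper]) (show 0 < ε / (2 * Real.pi) by positivity)
  refine not_avoids_lattice hv hvper hεpos fun x => ?_
  by_contra! hlt
  have hlip : ∀ i, 1 - c (x i + u x i - y i) ≤ 2 * ε := fun i => by
    have h1 : |Real.cos (2 * Real.pi * (x i + v x i)) -
        Real.cos (2 * Real.pi * (x i + u x i - y i))| ≤ ε := by
      refine (Real.abs_cos_sub_cos_le _ _).trans ?_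
      have h2 := hvu x i
      rw [le_div_iff₀ (by positivity)] at h2
      rw [← mul_sub, abs_mul, abs_of_pos (show 0 < 2 * Real.pi by positivity), mul_comm]
      have h4 : x i + v x i - (x i + u x i - y i) = v x i - (u x - y) i := by
        rw [Pi.sub_apply]; ring
      rwa [h4]
    have h3 := abs_le.1 h1
    simp only [hc]
    linarith [hlt i, h3.2]
  have hsum : F x ≤ d * (2 * ε) := by
    refine (Finset.sum_le_sum fun (i : Fin d) (_ : i ∈ Finset.univ) => hlip i).trans_eq ?_
    simp
  have := hFmin x
  have h5 : F x₀ = 2 * ((d : ℝ) + 1) * ε := by rw [hε]; field_simp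
  nlinarith

end Surjectivity

section InvarianceOfDomain

open MeasureTheory Metric

variable {d : ℕ}

/-- A map close to the identity on a closed ball has a zero there. -/
lemma exists_zero_of_near_id {F : (Fin d → ℝ) → (Fin d → ℝ)}
    (hF : ContinuousOn F (closedBall 0 (1 / 4)))
    (hnear : ∀ x ∈ closedBall (0 : Fin d → ℝ) (1 / 4), ‖F x - x‖ ≤ 1 / 4) :
    ∃ x ∈ closedBall (0 : Fin d → ℝ) (1 / 4), F x = 0 := by
  have hpi := Real.pi_pos
  set τ : (Fin d → ℝ) → (Fin d → ℝ) := fun x i =>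
    Real.arcsin (Real.sin (2 * Real.pi * x i)) / (2 * Real.pi) with hτ
  have hτc : Continuous τ := by
    refine continuous_pi fun i => Continuous.div_const (Real.continuous_arcsin.comp ?_) _
    fun_prop
  have hτper : ∀ x m, τ (x + intVec m) = τ x := fun x m => funext fun i => by
    simp only [hτ, Pi.add_apply, intVec_apply]
    rw [mul_add, mul_comm (2 * Real.pi) (m i : ℝ), Real.sin_add_int_mul_two_pi]
  have hτmem : ∀ x, τ x ∈ closedBall (0 : Fin d → ℝ) (1 / 4) := fun x => by
    rw [mem_closedBall_zero_iff, pi_norm_le_iff_of_nonneg (by norm_num)]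
    intro i
    simp only [hτ]
    rw [Real.norm_eq_abs, abs_div, abs_of_pos (show 0 < 2 * Real.pi by positivity),
      div_le_iff₀ (by positivity), abs_le]
    have h1 := Real.arcsin_le_pi_div_two (Real.sin (2 * Real.pi * x i))
    have h2 := Real.neg_pi_div_two_le_arcsin (Real.sin (2 * Real.pi * x i))
    constructor <;> linarith
  have hτid : ∀ x ∈ closedBall (0 : Fin d → ℝ) (1 / 4), τ x = x := fun x hx => funext fun i => by
    rw [mem_closedBall_zero_iff, pi_norm_le_iff_of_nonneg (by norm_num)] at hx
    have h := abs_le.1 (hx i)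
    simp only [hτ]
    rw [Real.arcsin_sin (by nlinarith) (by nlinarith)]
    field_simp
  obtain ⟨x, hx⟩ := surjective_id_add_periodic (u := fun x => F (τ x) - τ x)
    ((hF.comp_continuous hτc hτmem).sub hτc) (fun x m => by simp only [hτper]) 0
  have hx' : x + (F (τ x) - τ x) = 0 := hx
  have hxmem : x ∈ closedBall (0 : Fin d → ℝ) (1 / 4) := by
    rw [mem_closedBall_zero_iff, eq_neg_of_add_eq_zero_left hx', norm_neg]
    exact hnear _ (hτmem x)
  refine ⟨x, hxmem, ?_⟩
  rw [hτid x hxmem] at hx'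
  simpa using hx'

/-- Invariance of domain for a ball of radius `1 / 4`. -/
lemma image_closedBall_mem_nhds_aux {f : (Fin d → ℝ) → (Fin d → ℝ)}
    (hf : ContinuousOn f (closedBall 0 (1 / 4))) (hinj : InjOn f (closedBall 0 (1 / 4))) :
    f '' closedBall 0 (1 / 4) ∈ 𝓝 (f 0) := by
  set K : Set (Fin d → ℝ) := closedBall 0 (1 / 4) with hK
  have h0K : (0 : Fin d → ℝ) ∈ K := by simp [hK]
  have hKc : IsCompact K := isCompact_closedBall _ _
  have hCc : IsCompact (f '' K) := hKc.image_of_continuousOn hf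
  have : CompactSpace K := isCompact_iff_compactSpace.1 hKc
  have hemb : IsClosedEmbedding (K.domRestrict f) :=
    (continuousOn_iff_continuous_domRestrict.1 hf).isClosedEmbedding (injOn_iff_injective.1 hinj)
  obtain ⟨G, hG⟩ := ContinuousMap.exists_extension' hemb
    (⟨Subtype.val, continuous_subtype_val⟩ : C(K, Fin d → ℝ))
  have hGf : ∀ x ∈ K, G (f x) = x := fun x hx => congrFun hG ⟨x, hx⟩
  obtain ⟨ε', hε', hGε⟩ := Metric.continuousAt_iff.1 (G.continuous.continuousAt (x := f 0))
    (1 / 20) (by norm_num)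
  rw [hGf 0 h0K] at hGε
  by_contra hnot
  obtain ⟨ε, hε, hεε'⟩ : ∃ ε, 0 < ε ∧ 2 * ε < ε' := ⟨ε' / 3, by positivity, by linarith⟩
  obtain ⟨c, hcε, hcC⟩ : ∃ c, dist c (f 0) < ε ∧ c ∉ f '' K := by
    by_contra! h
    exact hnot (Filter.mem_of_superset (ball_mem_nhds _ hε) fun c hc => h c hc)
  set S₁ : Set (Fin d → ℝ) := f '' K ∩ {y | ε ≤ dist y c} with hS₁
  have hS₁c : IsCompact S₁ :=
    hCc.inter_right (isClosed_le continuous_const (continuous_id.dist continuous_const))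
  obtain ⟨μ, hμ, hGμ⟩ : ∃ μ : ℝ, 0 < μ ∧ ∀ y ∈ S₁, μ ≤ ‖G y‖ := by
    rcases S₁.eq_empty_or_nonempty with he | hne
    · exact ⟨1, one_pos, by simp [he]⟩
    · obtain ⟨y, hy, hmin⟩ := hS₁c.exists_isMinOn hne (G.continuous.norm.continuousOn)
      refine ⟨‖G y‖, norm_pos_iff.2 ?_, fun z hz => hmin hz⟩
      obtain ⟨⟨x, hx, rfl⟩, hxε⟩ := hy
      rw [hGf x hx]
      rintro rfl
      rw [mem_ofPred_eq, dist_comm] at hxε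
      exact absurd hcε (not_lt.2 hxε)
  obtain ⟨ν, hν, hνμ, hν10⟩ : ∃ ν : ℝ, 0 < ν ∧ 2 * ν < μ ∧ 2 * ν ≤ 1 / 15 :=
    ⟨min (μ / 3) (1 / 30), by positivity, by linarith [min_le_left (μ / 3) (1 / 30)],
      by linarith [min_le_right (μ / 3) (1 / 30)]⟩
  obtain ⟨P, hP, hPG, -⟩ := G.continuous.exists_contDiff_approx 1
    (continuous_const (y := ν)) fun _ => hν
  obtain ⟨s, hsν, hs⟩ : ∃ s : Fin d → ℝ, ‖s‖ < ν ∧ s ∉ P '' sphere c ε := by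
    by_contra! h
    have hnull : volume (P '' sphere c ε) = 0 :=
      addHaar_image_eq_zero_of_differentiableOn_of_addHaar_eq_zero volume
        (hP.differentiable one_ne_zero).differentiableOn
        (Measure.addHaar_sphere_of_ne_zero volume c hε.ne')
    have hball : volume (ball (0 : Fin d → ℝ) ν) = 0 :=
      measure_mono_null (fun s hs => h s (mem_ball_zero_iff.1 hs)) hnull
    exact (measure_ball_pos volume (0 : Fin d → ℝ) hν).ne' hball
  set Q : (Fin d → ℝ) → (Fin d → ℝ) := fun y => P y - s with hQ
  have hQG : ∀ y, ‖Q y - G y‖ ≤ 2 * ν := fun y => by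
    have h1 : Q y - G y = (P y - G y) - s := by simp only [hQ]; abel
    have h2 := hPG y
    rw [dist_eq_norm] at h2
    rw [h1]
    exact (norm_sub_le _ _).trans (by linarith)
  set Φ : (Fin d → ℝ) → (Fin d → ℝ) := fun y => c + (max (ε / dist y c) 1) • (y - c) with hΦ
  have hΦfar : ∀ y, ε ≤ dist y c → Φ y = y := fun y hy => by
    have h1 : ε / dist y c ≤ 1 := div_le_one_of_le₀ hy dist_nonneg
    simp [hΦ, max_eq_right h1]
  have hΦnear : ∀ y, y ≠ c → dist y c ≤ ε → dist (Φ y) c = ε := fun y hyc hy => by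
    have h0 : 0 < dist y c := dist_pos.2 hyc
    have h1 : 1 ≤ ε / dist y c := (one_le_div h0).2 hy
    simp only [hΦ]
    rw [max_eq_left h1, dist_eq_norm, add_sub_cancel_left, norm_smul, ← dist_eq_norm,
      Real.norm_of_nonneg (by positivity), div_mul_cancel₀ _ h0.ne']
  have hne : ∀ x ∈ K, f x ≠ c := fun x hx h => hcC ⟨x, hx, h⟩
  have hΦc : ContinuousOn (fun x => Φ (f x)) K := by
    simp only [hΦ]
    have h1 : ContinuousOn (fun x => ε / dist (f x) c) K :=
      continuousOn_const.div ((continuous_id.dist continuous_const).comp_continuousOn hf)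
        fun x hx =>
        dist_ne_zero.2 (hne x hx)
    fun_prop
  have hcont : ContinuousOn (fun x => Q (Φ (f x))) K :=
    (hP.continuous.sub continuous_const).comp_continuousOn hΦc
  obtain ⟨x, hx, hx0⟩ := exists_zero_of_near_id hcont fun x hx => by
    rcases le_total ε (dist (f x) c) with h | h
    · rw [hΦfar _ h]
      have := hQG (f x)
      rw [hGf x hx] at this
      linarith
    · have h1 : dist (f x) (f 0) < ε' :=
        (dist_triangle _ c _).trans_lt (by linarith)
      have h2 : dist (Φ (f x)) (f 0) < ε' :=
        (dist_triangle _ c _).trans_lt (by linarith [hΦnear _ (hne x hx) h])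
      have h3 := hGε h1
      have h4 := hGε h2
      rw [hGf x hx, dist_zero_right] at h3
      rw [dist_zero_right] at h4
      have h5 := hQG (Φ (f x))
      have h6 : Q (Φ (f x)) - x = (Q (Φ (f x)) - G (Φ (f x))) + G (Φ (f x)) - x := by abel
      rw [h6]
      have h7 := norm_sub_le (Q (Φ (f x)) - G (Φ (f x)) + G (Φ (f x))) x
      have h8 := norm_add_le (Q (Φ (f x)) - G (Φ (f x))) (G (Φ (f x)))
      linarith
  rcases le_total ε (dist (f x) c) with h | h
  · simp only [hΦfar _ h] at hx0
    have h1 := hQG (f x)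
    have h2 := hGμ (f x) ⟨⟨x, hx, rfl⟩, h⟩
    rw [hx0, zero_sub, norm_neg] at h1
    linarith
  · exact hs ⟨Φ (f x), hΦnear _ (hne x hx) h, sub_eq_zero.1 hx0⟩

/-- Invariance of domain: a continuous map `ℝ^d → ℝ^d` that is injective on balls of a fixed
radius is open. -/
theorem isOpenMap_of_injOn_closedBall {f : (Fin d → ℝ) → (Fin d → ℝ)} (hf : Continuous f)
    {r : ℝ} (hr : 0 < r) (hinj : ∀ x, InjOn f (closedBall x r)) : IsOpenMap f := by
  rw [isOpenMap_iff_nhds_le]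
  intro x s hs
  rw [Filter.mem_map] at hs
  obtain ⟨ρ, hρ, hρs⟩ := Metric.nhds_basis_closedBall.mem_iff.1 hs
  set t := 4 * min r ρ with ht
  have htpos : 0 < t := by positivity
  set A : (Fin d → ℝ) → (Fin d → ℝ) := fun z => x + t • z with hA
  have hmem : ∀ z ∈ closedBall (0 : Fin d → ℝ) (1 / 4), A z ∈ closedBall x (min r ρ) := by
    intro z hz
    rw [mem_closedBall_zero_iff] at hz
    rw [mem_closedBall, dist_eq_norm]
    simp only [hA]
    rw [add_sub_cancel_left, norm_smul, Real.norm_of_nonneg htpos.le]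
    nlinarith
  have hAinj : Injective A := fun z w h => by
    simpa [hA, htpos.ne'] using h
  have key := image_closedBall_mem_nhds_aux (f := fun z => f (A z))
    (by simp only [hA]; fun_prop) (fun z hz w hw h => hAinj <|
      hinj x (closedBall_subset_closedBall (min_le_left _ _) (hmem z hz))
        (closedBall_subset_closedBall (min_le_left _ _) (hmem w hw)) h)
  have h0 : A 0 = x := by simp [hA]
  rw [h0] at key
  refine Filter.mem_of_superset key ?_
  rintro _ ⟨z, hz, rfl⟩
  exact hρs (closedBall_subset_closedBall (min_le_right _ _) (hmem z hz))

end InvarianceOfDomain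

section Lifts

variable {d : ℕ}

lemma isLocallyInjective_torusMk : IsLocallyInjective (torusMk (d := d)) := fun x => by
  refine ⟨Metric.ball x (1 / 4), Metric.isOpen_ball, Metric.mem_ball_self (by norm_num), ?_⟩
  intro v hv w hw h
  have h1 : dist v w ≤ 1 / 2 := by
    have h2 := dist_triangle_right v w x
    have h3 := Metric.mem_ball.1 hv
    have h4 := Metric.mem_ball.1 hw
    linarith
  rw [dist_eq_norm] at h1
  have h2 := norm_sub_le_dist_torusMk h1
  rw [h, dist_self] at h2
  exact sub_eq_zero.1 (norm_le_zero_iff.1 h2)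

/-- Two continuous maps to `ℝ^d` with the same projection to the torus agree as soon as they agree
at a point. -/
lemma eq_of_torusMk_eq {A : Type*} [TopologicalSpace A] [PreconnectedSpace A]
    {g₁ g₂ : A → Fin d → ℝ} (h₁ : Continuous g₁) (h₂ : Continuous g₂)
    (h : ∀ a, torusMk (g₁ a) = torusMk (g₂ a)) (a : A) (ha : g₁ a = g₂ a) : g₁ = g₂ :=
  (T2Space.isSeparatedMap _).eq_of_comp_eq isLocallyInjective_torusMk h₁ h₂ (funext h) a ha

/-- A continuous map whose projection to the torus is periodic is equivariant. -/
lemma exists_int_of_torusMk_eq {g₁ g₂ : (Fin d → ℝ) → Fin d → ℝ} (h₁ : Continuous g₁)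
    (h₂ : Continuous g₂) (h : ∀ a, torusMk (g₁ a) = torusMk (g₂ a)) :
    ∃ m, ∀ x, g₁ x = g₂ x + intVec m := by
  obtain ⟨m, hm⟩ := torusMk_eq_iff.1 (h 0)
  refine ⟨m, fun x => congrFun (eq_of_torusMk_eq h₁ (h₂.add continuous_const)
    (fun a => ?_) 0 hm) x⟩
  simp [h]

/-- Continuous maps from `ℝ^d` to the torus lift to `ℝ^d`. -/
lemma exists_lift_torusMk {g : (Fin d → ℝ) → Fin d → UnitAddCircle} (hg : Continuous g)
    {a e : Fin d → ℝ} (hae : torusMk e = g a) :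
    ∃ G : (Fin d → ℝ) → Fin d → ℝ, Continuous G ∧ G a = e ∧ ∀ x, torusMk (G x) = g x := by
  have h : ∀ i, ∃ G : C(Fin d → ℝ, ℝ), G a = e i ∧ ∀ x, ((G x : ℝ) : UnitAddCircle) = g x i := by
    intro i
    obtain ⟨G, ⟨hG, hG'⟩, -⟩ :=
      (AddCircle.isCoveringMap_coe (1 : ℝ)).existsUnique_continuousMap_lifts
      ⟨fun x => g x i, (continuous_apply i).comp hg⟩ a (e i) (congrFun hae i)
    exact ⟨G, hG, fun x => congrFun hG' x⟩
  choose G hGa hG using h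
  exact ⟨fun x i => G i x, by fun_prop, funext hGa, fun x => funext fun i => hG i x⟩

/-- A positively expansive continuous map of the torus lifts to an equivariant homeomorphism. -/
theorem exists_homeomorph_lift {T : (Fin d → UnitAddCircle) → (Fin d → UnitAddCircle)}
    (hT : Continuous T) {δ : ℝ} (hδ : 0 < δ)
    (hexp : ∀ x y, x ≠ y → ∃ n : ℕ, δ < dist (T^[n] x) (T^[n] y)) :
    ∃ F : (Fin d → ℝ) ≃ₜ (Fin d → ℝ), (∀ x, torusMk (F x) = T (torusMk x)) ∧
      ∃ A : (Fin d → ℤ) →+ (Fin d → ℤ), ∀ x m, F (x + intVec m) = F x + intVec (A m) := by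
  have hTinj : ∀ x y, dist x y ≤ δ → T x = T y → x = y := by
    intro x y hxy h
    by_contra hne
    obtain ⟨n, hn⟩ := hexp x y hne
    cases n with
    | zero => exact absurd hxy (not_le.2 hn)
    | succ n =>
      rw [iterate_succ_apply, iterate_succ_apply, h, dist_self] at hn
      exact absurd hn (not_lt.2 hδ.le)
  obtain ⟨e, he⟩ := torusMk_surjective (T (torusMk 0))
  obtain ⟨F, hFc, hF0, hF⟩ := exists_lift_torusMk (hT.comp continuous_torusMk) he
  simp only [comp_apply] at hF
  have hFopen : IsOpenMap F := by
    refine isOpenMap_of_injOn_closedBall hFc (r := min δ (1 / 2) / 2) (by positivity) ?_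
    intro x v hv w hw h
    have h1 : ‖v - w‖ ≤ min δ (1 / 2) := by
      rw [← dist_eq_norm]
      have h2 := dist_triangle_right v w x
      have h3 := Metric.mem_closedBall.1 hv
      have h4 := Metric.mem_closedBall.1 hw
      linarith
    have h2 : torusMk v = torusMk w :=
      hTinj _ _ ((dist_torusMk_le v w).trans (h1.trans (min_le_left _ _))) (by rw [← hF, ← hF, h])
    have h3 := norm_sub_le_dist_torusMk (h1.trans (min_le_right _ _))
    rw [h2, dist_self] at h3
    exact sub_eq_zero.1 (norm_le_zero_iff.1 h3)
  have hTopen : IsOpenMap T := by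
    intro U hU
    have : T '' U = torusMk '' (F '' (torusMk ⁻¹' U)) := by
      rw [image_image]
      simp only [hF]
      rw [← image_image T torusMk, image_preimage_eq _ torusMk_surjective]
    rw [this]
    exact isOpenQuotientMap_torusMk.isOpenMap _ (hFopen _ (hU.preimage continuous_torusMk))
  have hTcov : IsCoveringMap T := by
    rw [← isLocalHomeomorph_iff_isCoveringMap, isLocalHomeomorph_iff_isOpenEmbedding_restrict]
    intro x
    refine ⟨Metric.ball x (δ / 2), Metric.ball_mem_nhds x (by positivity),
      .of_continuous_injective_isOpenMap (hT.comp continuous_subtype_val) ?_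
        (hTopen.comp Metric.isOpen_ball.isOpenMap_subtype_val)⟩
    rintro ⟨v, hv⟩ ⟨w, hw⟩ h
    refine Subtype.ext (hTinj v w ?_ h)
    have h2 := dist_triangle_right v w x
    have h3 := Metric.mem_ball.1 hv
    have h4 := Metric.mem_ball.1 hw
    linarith
  obtain ⟨q, ⟨hq0, hq⟩, -⟩ := hTcov.existsUnique_continuousMap_lifts
    ⟨torusMk, continuous_torusMk⟩ (F 0) (torusMk 0) (hF 0).symm
  have hq' : ∀ x, T (q x) = torusMk x := fun x => congrFun hq x
  obtain ⟨S, hSc, hS0, hS⟩ := exists_lift_torusMk q.continuous hq0.symm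
  have hFS : F ∘ S = id := eq_of_torusMk_eq (hFc.comp hSc) continuous_id
    (fun x => by simp only [comp_apply, id, hF, hS, hq']) (F 0) (by simp [hS0])
  have hFS' : ∀ x, F (S x) = x := congrFun hFS
  have hqF : (torusMk ∘ S ∘ F) = torusMk := hTcov.eq_of_comp_eq
    (continuous_torusMk.comp (hSc.comp hFc)) continuous_torusMk
    (funext fun x => by simp only [comp_apply, ← hF, hFS']) 0 (by simp only [comp_apply, hS0])
  have hSF : S ∘ F = id := eq_of_torusMk_eq (hSc.comp hFc) continuous_id (congrFun hqF) 0 hS0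
  refine ⟨⟨⟨F, S, congrFun hSF, congrFun hFS⟩, hFc, hSc⟩, hF, ?_⟩
  have hA : ∀ m, ∃ n, ∀ x, F (x + intVec m) = F x + intVec n := fun m =>
    exists_int_of_torusMk_eq (hFc.comp (continuous_add_const _)) hFc fun x => by
      simp [hF]
  choose A hA using hA
  refine ⟨AddMonoidHom.mk' A fun m n => intVec_injective ?_, fun x m => hA m x⟩
  have h := hA (m + n) 0
  rw [map_add, ← add_assoc, hA, hA, add_assoc, add_right_inj] at h
  rw [map_add, ← h]

end Lifts

/-- The real linear extension of an endomorphism of `ℤ^d`. -/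
noncomputable def realExt {d : ℕ} (A : (Fin d → ℤ) →+ (Fin d → ℤ)) :
    (Fin d → ℝ) →ₗ[ℝ] (Fin d → ℝ) :=
  Fintype.linearCombination ℝ fun j => intVec (A (Pi.single j 1))

section Contraction

variable {d : ℕ}

lemma realExt_intVec (A : (Fin d → ℤ) →+ (Fin d → ℤ)) (m : Fin d → ℤ) :
    realExt A (intVec m) = intVec (A m) := by
  have h : m = ∑ j, m j • (Pi.single j 1 : Fin d → ℤ) := by
    ext i
    simp [Finset.sum_apply, Pi.single_apply]
  conv_rhs => rw [h]
  rw [map_sum, map_sum, realExt, Fintype.linearCombination_apply]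
  refine Finset.sum_congr rfl fun j _ => ?_
  rw [map_zsmul, map_zsmul, intVec_apply, Int.cast_smul_eq_zsmul]

lemma continuous_realExt (A : (Fin d → ℤ) →+ (Fin d → ℤ)) : Continuous (realExt A) :=
  LinearMap.continuous_of_finiteDimensional _

lemma exists_bound_of_periodic {E : Type*} [NormedAddCommGroup E] {u : (Fin d → ℝ) → E}
    (hu : Continuous u) (hper : ∀ x m, u (x + intVec m) = u x) : ∃ C, ∀ x, ‖u x‖ ≤ C := by
  obtain ⟨C, hC⟩ := (isCompact_Icc (a := (0 : Fin d → ℝ)) (b := 1)).exists_bound_of_continuousOn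
    hu.continuousOn
  refine ⟨C, fun x => ?_⟩
  obtain ⟨m, hm⟩ := exists_sub_intVec_mem_Icc x
  have h := hper (x - intVec m) m
  rw [sub_add_cancel] at h
  rw [h]
  exact hC _ hm

/-- Iterates of an equivariant map are equivariant. -/
lemma exists_iterate_equivariant {F : (Fin d → ℝ) → (Fin d → ℝ)}
    {A : (Fin d → ℤ) →+ (Fin d → ℤ)} (hA : ∀ x m, F (x + intVec m) = F x + intVec (A m)) (n : ℕ) :
    ∃ B : (Fin d → ℤ) →+ (Fin d → ℤ), ∀ x m, F^[n] (x + intVec m) = F^[n] x + intVec (B m) := by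
  induction n with
  | zero => exact ⟨AddMonoidHom.id _, fun x m => rfl⟩
  | succ n ih =>
    obtain ⟨B, hB⟩ := ih
    refine ⟨A.comp B, fun x m => ?_⟩
    rw [iterate_succ_apply', iterate_succ_apply', hB, hA, AddMonoidHom.comp_apply]

/-- A map with a uniform modulus at one small scale has linear growth. -/
lemma norm_sub_le_of_chain {E : Type*} [NormedAddCommGroup E] [NormedSpace ℝ E] {g : E → E}
    {η ε : ℝ} (hη : 0 < η) (hε : 0 ≤ ε) (h : ∀ a b, ‖a - b‖ < η → ‖g a - g b‖ ≤ ε) (a b : E) :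
    ‖g a - g b‖ ≤ (‖a - b‖ / η + 1) * ε := by
  set k : ℕ := ⌊‖a - b‖ / η⌋₊ + 1 with hk
  have hk1 : ‖a - b‖ / η < k := by simpa [hk] using Nat.lt_floor_add_one (‖a - b‖ / η)
  have hk2 : (k : ℝ) ≤ ‖a - b‖ / η + 1 := by
    simpa [hk] using Nat.floor_le (show 0 ≤ ‖a - b‖ / η by positivity)
  have hk0 : (0 : ℝ) < k := by simp only [hk]; positivity
  set c : ℕ → E := fun i => a + ((i : ℝ) / k) • (b - a) with hc
  have h1 := dist_le_range_sum_of_dist_le (f := fun i => g (c i)) k (d := fun _ => ε) (by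
    intro i _
    rw [dist_eq_norm]
    refine h _ _ ?_
    have h2 : c i - c (i + 1) = (1 / (k : ℝ)) • (a - b) := by
      simp only [hc]
      push_cast
      rw [add_sub_add_left_eq_sub, ← sub_smul, ← neg_sub a b, smul_neg, ← neg_smul]
      congr 1
      field_simp
      ring
    rw [h2, norm_smul, Real.norm_of_nonneg (by positivity), one_div, inv_mul_lt_iff₀ hk0]
    rwa [div_lt_iff₀ hη] at hk1)
  have h2 : c 0 = a := by simp [hc]
  have h3 : c k = b := by simp [hc, hk0.ne']
  simp only [h2, h3, Finset.sum_const, Finset.card_range, nsmul_eq_mul, dist_eq_norm] at h1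
  exact h1.trans (by gcongr)

variable {F : (Fin d → ℝ) ≃ₜ (Fin d → ℝ)} {A : (Fin d → ℤ) →+ (Fin d → ℤ)}

/-- Uniform expansivity. -/
lemma exists_uniform_expansive (hA : ∀ x m, F (x + intVec m) = F x + intVec (A m)) {α : ℝ}
    (hα : α ≤ 1) (hexp : ∀ x y, (∀ n : ℕ, ‖F^[n] x - F^[n] y‖ ≤ α) → x = y) {ε : ℝ} (hε : 0 < ε) :
    ∃ N : ℕ, ∀ x y, (∀ n ≤ N, ‖F^[n] x - F^[n] y‖ ≤ α) → ‖x - y‖ < ε := by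
  set t : ℕ → Set ((Fin d → ℝ) × (Fin d → ℝ)) := fun N =>
    {z | (∀ n ≤ N, ‖F^[n] z.1 - F^[n] z.2‖ ≤ α) ∧ ε ≤ ‖z.1 - z.2‖} with ht
  have hFn : ∀ n, Continuous (F^[n]) := fun n => F.continuous.iterate n
  have htc : ∀ N, IsClosed (t N) := fun N => by
    have h1 : IsClosed (⋂ n ≤ N, {z : (Fin d → ℝ) × (Fin d → ℝ) | ‖F^[n] z.1 - F^[n] z.2‖ ≤ α}) :=
      isClosed_biInter fun n _ => isClosed_le
        (((hFn n).comp continuous_fst).sub ((hFn n).comp continuous_snd)).norm continuous_const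
    have h2 : IsClosed {z : (Fin d → ℝ) × (Fin d → ℝ) | ε ≤ ‖z.1 - z.2‖} :=
      isClosed_le continuous_const (continuous_fst.sub continuous_snd).norm
    convert h1.inter h2 using 1
    ext z
    simp [ht]
  have hanti : Antitone t := fun N M hNM z hz => ⟨fun n hn => hz.1 n (hn.trans hNM), hz.2⟩
  have hK : IsCompact (Icc (0 : Fin d → ℝ) 1 ×ˢ Metric.closedBall (0 : Fin d → ℝ) 2) :=
    isCompact_Icc.prod (isCompact_closedBall _ _)
  obtain ⟨N, hN⟩ := hK.elim_directed_family_closed t htc (by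
    rw [eq_empty_iff_forall_notMem]
    rintro z ⟨-, hz⟩
    rw [mem_iInter] at hz
    have h1 := hexp z.1 z.2 fun n => (hz n).1 n le_rfl
    have h2 := (hz 0).2
    rw [h1, sub_self, norm_zero] at h2
    exact absurd hε (not_lt.2 h2)) hanti.directed_ge
  refine ⟨N, fun x y hxy => ?_⟩
  by_contra! hle
  obtain ⟨m, hm⟩ := exists_sub_intVec_mem_Icc x
  have hmem : (x - intVec m, y - intVec m) ∈ (∅ : Set ((Fin d → ℝ) × (Fin d → ℝ))) := by
    rw [← hN]
    refine ⟨⟨hm, ?_⟩, fun n hn => ?_, by simpa using hle⟩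
    · rw [mem_closedBall_zero_iff]
      have h1 : ‖x - intVec m‖ ≤ 1 := by
        rw [pi_norm_le_iff_of_nonneg zero_le_one]
        intro i
        rw [Real.norm_eq_abs, abs_le]
        have h3 := hm.1 i
        have h4 := hm.2 i
        simp only [Pi.zero_apply, Pi.one_apply] at h3 h4
        constructor <;> linarith
      have h2 : ‖x - y‖ ≤ 1 := (hxy 0 (Nat.zero_le _)).trans hα
      have h3 : y - intVec m = (x - intVec m) - (x - y) := by abel
      change ‖y - intVec m‖ ≤ 2
      rw [h3]
      exact (norm_sub_le _ _).trans (by linarith)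
    · obtain ⟨B, hB⟩ := exists_iterate_equivariant hA n
      have h1 := hB (x - intVec m) m
      have h2 := hB (y - intVec m) m
      rw [sub_add_cancel] at h1 h2
      have h3 := hxy n hn
      rw [h1, h2, add_sub_add_right_eq_sub] at h3
      exact h3
  exact hmem

lemma symm_equivariant (hA : ∀ x m, F (x + intVec m) = F x + intVec (A m)) (x : Fin d → ℝ)
    (m : Fin d → ℤ) : F.symm (x + intVec (A m)) = F.symm x + intVec m := by
  rw [Homeomorph.symm_apply_eq, hA, Homeomorph.apply_symm_apply]

lemma uniformContinuous_symm (hA : ∀ x m, F (x + intVec m) = F x + intVec (A m)) :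
    UniformContinuous F.symm := by
  have hK : IsCompact (F '' Icc 0 1) := isCompact_Icc.image F.continuous
  have hu := hK.cthickening (r := 1) |>.uniformContinuousOn_of_continuous
    F.symm.continuous.continuousOn
  rw [Metric.uniformContinuousOn_iff] at hu
  rw [Metric.uniformContinuous_iff]
  intro ε hε
  obtain ⟨η, hη, h⟩ := hu ε hε
  refine ⟨min η 1, by positivity, fun a b hab => ?_⟩
  obtain ⟨m, hm⟩ := exists_sub_intVec_mem_Icc (F.symm a)
  have hS : ∀ c, F.symm (c - intVec (A m)) = F.symm c - intVec m := fun c => by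
    have h1 := symm_equivariant hA (c - intVec (A m)) m
    rw [sub_add_cancel] at h1
    exact eq_sub_of_add_eq h1.symm
  have ha : a - intVec (A m) ∈ F '' Icc 0 1 :=
    ⟨_, hm, by rw [← hS, Homeomorph.apply_symm_apply]⟩
  have hdist : dist (b - intVec (A m)) (a - intVec (A m)) ≤ 1 := by
    rw [dist_sub_right, dist_comm]
    exact hab.le.trans (min_le_right _ _)
  have h2 := h (a - intVec (A m)) (Metric.self_subset_cthickening _ ha) (b - intVec (A m))
    (Metric.mem_cthickening_of_dist_le _ _ _ _ ha hdist) (by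
      rw [dist_sub_right]
      exact hab.trans_le (min_le_left _ _))
  rwa [hS, hS, dist_sub_right] at h2

lemma iterate_symm_cancel {j k : ℕ} (h : k ≤ j) (a : Fin d → ℝ) :
    F^[k] (F.symm^[j] a) = F.symm^[j - k] a := by
  have hinv : LeftInverse F F.symm := F.apply_symm_apply
  obtain ⟨i, rfl⟩ := Nat.exists_eq_add_of_le h
  rw [Nat.add_sub_cancel_left, iterate_add_apply]
  exact hinv.iterate k _

/-- The inverse of the lift of an expansive map is eventually uniformly contracting. -/
lemma exists_contracting_symm (hA : ∀ x m, F (x + intVec m) = F x + intVec (A m)) {α : ℝ}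
    (hα0 : 0 < α) (hα : α ≤ 1) (hexp : ∀ x y, (∀ n : ℕ, ‖F^[n] x - F^[n] y‖ ≤ α) → x = y)
    {ε : ℝ} (hε : 0 < ε) :
    ∃ N : ℕ, ∀ j ≥ N, ∀ a b, ‖F.symm^[j] a - F.symm^[j] b‖ ≤ ε * (‖a - b‖ + 1) := by
  have hS := uniformContinuous_symm hA
  have hSit : ∀ n, UniformContinuous (F.symm^[n]) := fun n => by
    induction n with
    | zero => exact uniformContinuous_id
    | succ n ih => rw [iterate_succ']; exact hS.comp ih
  obtain ⟨θ, hθ, hSθ⟩ := Metric.uniformContinuous_iff.1 hS α hα0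
  obtain ⟨N₀, hN₀⟩ := exists_uniform_expansive hA hα hexp hθ
  obtain ⟨η, hη, hSη⟩ : ∃ η > 0, ∀ a b, ‖a - b‖ < η →
      ∀ j ≤ N₀, ‖F.symm^[j] a - F.symm^[j] b‖ ≤ α := by
    have : ∀ j, ∃ η > 0, ∀ a b, ‖a - b‖ < η → ‖F.symm^[j] a - F.symm^[j] b‖ ≤ α := fun j => by
      obtain ⟨η, hη, h⟩ := Metric.uniformContinuous_iff.1 (hSit j) α hα0
      refine ⟨η, hη, fun a b hab => ?_⟩
      rw [← dist_eq_norm] at hab ⊢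
      exact (h hab).le
    choose η hη h using this
    refine ⟨(Finset.range (N₀ + 1)).inf' Finset.nonempty_range_add_one η, ?_,
      fun a b hab j hj => h j a b ?_⟩
    · rw [gt_iff_lt, Finset.lt_inf'_iff]
      exact fun j _ => hη j
    · exact hab.trans_le (Finset.inf'_le _ (Finset.mem_range.2 (Nat.lt_succ_of_le hj)))
  have hall : ∀ a b, ‖a - b‖ < η → ∀ j, ‖F.symm^[j] a - F.symm^[j] b‖ ≤ α := by
    intro a b hab j
    induction j using Nat.strong_induction_on with
    | _ j ih =>
      rcases le_or_gt j N₀ with hj | hj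
      · exact hSη a b hab j hj
      · obtain ⟨i, rfl⟩ : ∃ i, j = i + 1 := ⟨j - 1, by omega⟩
        have h1 := hN₀ (F.symm^[i] a) (F.symm^[i] b) fun n hn => by
          rw [iterate_symm_cancel (by omega), iterate_symm_cancel (by omega)]
          exact ih _ (by omega)
        rw [iterate_succ_apply', iterate_succ_apply', ← dist_eq_norm]
        rw [← dist_eq_norm] at h1
        exact (hSθ h1).le
  set ε' := ε * min η 1 with hε'
  obtain ⟨N, hN⟩ := exists_uniform_expansive hA hα hexp (show 0 < ε' by positivity)
  refine ⟨N, fun j hj a b => ?_⟩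
  have h1 := norm_sub_le_of_chain (g := F.symm^[j]) hη (show 0 ≤ ε' by positivity)
    (fun a b hab => (hN _ _ fun n hn => by
      rw [iterate_symm_cancel (by omega), iterate_symm_cancel (by omega)]
      exact hall a b hab _).le) a b
  refine h1.trans ?_
  have h2 : ‖a - b‖ / η * min η 1 ≤ ‖a - b‖ := by
    rw [div_mul_eq_mul_div, div_le_iff₀ hη]
    exact mul_le_mul_of_nonneg_left (min_le_left _ _) (norm_nonneg _)
  have h3 : (‖a - b‖ / η + 1) * min η 1 ≤ ‖a - b‖ + 1 := by
    rw [add_mul, one_mul]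
    exact add_le_add h2 (min_le_right _ _)
  calc (‖a - b‖ / η + 1) * ε' = ε * ((‖a - b‖ / η + 1) * min η 1) := by rw [hε']; ring
    _ ≤ ε * (‖a - b‖ + 1) := by gcongr

lemma not_surjective_of_contracting [NeZero d]
    (hA : ∀ x m, F (x + intVec m) = F x + intVec (A m))
    (hcontr : ∀ ε > 0, ∃ N : ℕ, ∀ j ≥ N, ∀ a b,
      ‖F.symm^[j] a - F.symm^[j] b‖ ≤ ε * (‖a - b‖ + 1)) : ¬ Surjective A := by
  intro hsurj
  have hS : ∀ j : ℕ, ∀ e : Fin d → ℤ, e ≠ 0 →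
      ∃ e' ≠ 0, ∀ x, F.symm^[j] (x + intVec e) = F.symm^[j] x + intVec e' := by
    intro j
    induction j with
    | zero => exact fun e he => ⟨e, he, fun x => rfl⟩
    | succ j ih =>
      intro e he
      obtain ⟨e₁, rfl⟩ := hsurj e
      obtain ⟨e', he', h⟩ := ih e₁ (by rintro rfl; simp at he)
      refine ⟨e', he', fun x => ?_⟩
      rw [iterate_succ_apply, iterate_succ_apply, symm_equivariant hA, h]
  set e : Fin d → ℤ := fun _ => 1 with he
  have he0 : e ≠ 0 := fun h => one_ne_zero (congrFun h 0)
  obtain ⟨N, hN⟩ := hcontr (1 / (2 * (‖intVec e‖ + 1))) (by positivity)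
  obtain ⟨e', he', h⟩ := hS N e he0
  have h1 := hN N le_rfl (0 + intVec e) 0
  rw [h, add_sub_cancel_left, zero_add, sub_zero] at h1
  have h2 := norm_intVec_ge he'
  have h3 : 1 / (2 * (‖intVec e‖ + 1)) * (‖intVec e‖ + 1) = 1 / 2 := by
    have : ‖intVec e‖ + 1 ≠ 0 := by positivity
    field_simp
  rw [h3] at h1
  linarith

lemma norm_sub_le_of_contracting {ε : ℝ} {N : ℕ}
    (hN : ∀ j ≥ N, ∀ a b, ‖F.symm^[j] a - F.symm^[j] b‖ ≤ ε * (‖a - b‖ + 1)) {j : ℕ} (hj : N ≤ j)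
    (x y : Fin d → ℝ) : ‖x - y‖ ≤ ε * (‖F^[j] x - F^[j] y‖ + 1) := by
  have h := hN j hj (F^[j] x) (F^[j] y)
  have hinv : LeftInverse F.symm F := F.symm_apply_apply
  rwa [hinv.iterate j x, hinv.iterate j y] at h

/-- Some iterate of the lift has an expanding linear part. -/
lemma exists_iterate_expanding (hA : ∀ x m, F (x + intVec m) = F x + intVec (A m))
    (hcontr : ∀ ε > 0, ∃ N : ℕ, ∀ j ≥ N, ∀ a b,
      ‖F.symm^[j] a - F.symm^[j] b‖ ≤ ε * (‖a - b‖ + 1)) :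
    ∃ (j : ℕ) (B : (Fin d → ℤ) →+ (Fin d → ℤ)),
      (∀ x m, F^[j] (x + intVec m) = F^[j] x + intVec (B m)) ∧
      ∀ v, ‖v‖ ≤ 1 / 2 * ‖realExt B v‖ := by
  obtain ⟨N, hN⟩ := hcontr (1 / 2) (by norm_num)
  obtain ⟨B, hB⟩ := exists_iterate_equivariant hA N
  refine ⟨N, B, hB, fun v => ?_⟩
  obtain ⟨C, hC⟩ := exists_bound_of_periodic (u := fun x => F^[N] x - realExt B x)
    ((F.continuous.iterate N).sub (continuous_realExt B)) fun x m => by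
      simp only [hB, map_add, realExt_intVec, add_sub_add_right_eq_sub]
  have key : ∀ s : ℝ, 0 < s → ‖v‖ - 1 / 2 * ‖realExt B v‖ ≤ (1 / 2 * (2 * C + 1)) * s⁻¹ := by
    intro s hs
    have h1 := norm_sub_le_of_contracting hN le_rfl (s • v) 0
    have h2 : F^[N] (s • v) - F^[N] 0 = s • realExt B v +
        ((F^[N] (s • v) - realExt B (s • v)) - (F^[N] 0 - realExt B 0)) := by
      rw [map_smul, map_zero]; abel
    have h3 := norm_add_le (s • realExt B v)
      ((F^[N] (s • v) - realExt B (s • v)) - (F^[N] 0 - realExt B 0))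
    have h4 := norm_sub_le (F^[N] (s • v) - realExt B (s • v)) (F^[N] 0 - realExt B 0)
    have h5 := hC (s • v)
    have h6 := hC 0
    rw [← h2, norm_smul, Real.norm_of_nonneg hs.le] at h3
    rw [sub_zero, norm_smul, Real.norm_of_nonneg hs.le] at h1
    rw [← div_eq_mul_inv, le_div_iff₀ hs]
    linarith
  have hlim : Filter.Tendsto (fun s : ℝ => (1 / 2 * (2 * C + 1)) * s⁻¹) Filter.atTop (𝓝 0) := by
    simpa using tendsto_inv_atTop_zero.const_mul (1 / 2 * (2 * C + 1))
  have := ge_of_tendsto hlim ((Filter.eventually_gt_atTop 0).mono key)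
  linarith

end Contraction

/-- The endomorphism of the torus induced by an endomorphism of `ℤ^d`. -/
def toralEnd {d : ℕ} (B : (Fin d → ℤ) →+ (Fin d → ℤ)) :
    (Fin d → UnitAddCircle) →+ (Fin d → UnitAddCircle) where
  toFun x i := ∑ j, B (Pi.single j 1) i • x j
  map_zero' := by ext; simp
  map_add' x y := by ext i; simp [smul_add, Finset.sum_add_distrib]

section Conjugacy

variable {d : ℕ}

lemma toralEnd_torusMk (B : (Fin d → ℤ) →+ (Fin d → ℤ)) (v : Fin d → ℝ) :
    toralEnd B (torusMk v) = torusMk (realExt B v) := by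
  ext i
  have h : realExt B v i = ∑ j, B (Pi.single j 1) i • v j := by
    simp [realExt, Fintype.linearCombination_apply, mul_comm]
  rw [torusMk_apply, h]
  change ∑ j, B (Pi.single j 1) i • ((v j : ℝ) : UnitAddCircle) =
    (QuotientAddGroup.mk' (AddSubgroup.zmultiples (1 : ℝ))) (∑ j, B (Pi.single j 1) i • v j)
  rw [map_sum]
  rfl

lemma continuous_toralEnd (B : (Fin d → ℤ) →+ (Fin d → ℤ)) : Continuous (toralEnd B) := by
  refine continuous_pi fun i => ?_
  change Continuous fun x : Fin d → UnitAddCircle => ∑ j, B (Pi.single j 1) i • x j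
  fun_prop

/-- No real-valued function observes a toral map whose lift acts non-surjectively on `ℤ^d`. -/
lemma exists_not_observed_real {T : (Fin d → UnitAddCircle) → (Fin d → UnitAddCircle)}
    {F : (Fin d → ℝ) ≃ₜ (Fin d → ℝ)} (hF : ∀ x, torusMk (F x) = T (torusMk x))
    {A : (Fin d → ℤ) →+ (Fin d → ℤ)} (hA : ∀ x m, F (x + intVec m) = F x + intVec (A m))
    (hsurj : ¬ Surjective A) (f : C(Fin d → UnitAddCircle, ℝ)) :
    ¬ ∀ x y, x ≠ y → ∃ n : ℕ, f (T^[n] x) ≠ f (T^[n] y) := by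
  intro hobs
  obtain ⟨m, hm⟩ : ∃ m, ∀ k, A k ≠ m := by simpa [Surjective] using hsurj
  set g : (Fin d → ℝ) → ℝ := fun w => f (torusMk (F.symm w)) with hg
  have hgc : Continuous g :=
    f.continuous.comp (continuous_torusMk.comp F.symm.continuous)
  have hne : ∀ w, g (w + intVec m) - g w ≠ 0 := by
    intro w h0
    have hT : ∀ w, T (torusMk (F.symm w)) = torusMk w := fun w => by
      rw [← hF, Homeomorph.apply_symm_apply]
    obtain ⟨n, hn⟩ := hobs (torusMk (F.symm (w + intVec m))) (torusMk (F.symm w)) (by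
      intro h
      obtain ⟨k, hk⟩ := torusMk_eq_iff.1 h
      have h1 := congrArg F hk
      rw [hA, Homeomorph.apply_symm_apply, Homeomorph.apply_symm_apply, add_right_inj] at h1
      exact hm k (intVec_injective h1.symm))
    cases n with
    | zero => exact hn (sub_eq_zero.1 h0)
    | succ n =>
      rw [iterate_succ_apply, iterate_succ_apply, hT, hT, map_add, torusMk_intVec, add_zero] at hn
      exact hn rfl
  obtain ⟨x, -, hx⟩ := isCompact_univ.exists_isMaxOn univ_nonempty f.continuous.continuousOn
  obtain ⟨v, rfl⟩ := torusMk_surjective x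
  have hmax : ∀ w, g w ≤ g (F v) := fun w => by
    simp only [hg, Homeomorph.symm_apply_apply]
    exact hx (mem_univ _)
  obtain ⟨w, hw⟩ := mem_range_of_exists_le_of_exists_ge (c := (0 : ℝ))
    (f := fun w => g (w + intVec m) - g w)
    ((hgc.comp (continuous_add_const (intVec m))).sub hgc)
    ⟨F v, sub_nonpos.2 (hmax _)⟩ ⟨F v - intVec m, by
      rw [sub_add_cancel]; exact sub_nonneg.2 (hmax _)⟩
  exact hne w hw

/-- A map of `ℝ^d` with expanding linear part and no bounded pairs of orbits is semiconjugate to its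
linear part through an injective map of the torus. -/
lemma exists_injective_conj_toralEnd {R : (Fin d → ℝ) → (Fin d → ℝ)} (hR : Continuous R)
    {B : (Fin d → ℤ) →+ (Fin d → ℤ)} (hB : ∀ x m, R (x + intVec m) = R x + intVec (B m))
    (hBexp : ∀ v, ‖v‖ ≤ 1 / 2 * ‖realExt B v‖)
    (hsep : ∀ x y C, (∀ n : ℕ, ‖R^[n] x - R^[n] y‖ ≤ C) → x = y) :
    ∃ H : C(Fin d → UnitAddCircle, Fin d → UnitAddCircle), Injective H ∧
      ∀ v, H (torusMk (R v)) = toralEnd B (H (torusMk v)) := by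
  have hinj : Injective (realExt B) := (injective_iff_map_eq_zero _).2 fun v hv => by
    have := hBexp v
    rw [hv, norm_zero, mul_zero] at this
    exact norm_le_zero_iff.1 this
  set b : (Fin d → ℝ) ≃ₗ[ℝ] (Fin d → ℝ) := LinearEquiv.ofInjectiveEndo (realExt B) hinj with hb
  have hbB : ∀ v, b v = realExt B v := fun v => rfl
  have hbs : ∀ v, ‖b.symm v‖ ≤ 1 / 2 * ‖v‖ := fun v => by
    have := hBexp (b.symm v)
    rwa [← hbB, LinearEquiv.apply_symm_apply] at this
  have hbc : Continuous b.symm := LinearMap.continuous_of_finiteDimensional b.symm.toLinearMap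
  have hbit : ∀ n v, ‖b.symm^[n] v‖ ≤ (1 / 2) ^ n * ‖v‖ := by
    intro n
    induction n with
    | zero => simp
    | succ n ih =>
      intro v
      rw [iterate_succ_apply', pow_succ', mul_assoc]
      exact (hbs _).trans (by gcongr; exact ih v)
  set u : (Fin d → ℝ) → (Fin d → ℝ) := fun x => R x - realExt B x with hu
  have huc : Continuous u := hR.sub (continuous_realExt B)
  have huper : ∀ x m, u (x + intVec m) = u x := fun x m => by
    simp only [hu, hB, map_add, realExt_intVec, add_sub_add_right_eq_sub]
  obtain ⟨C, hC⟩ := exists_bound_of_periodic huc huper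
  have hC0 : 0 ≤ C := (norm_nonneg _).trans (hC 0)
  set s : ℕ → (Fin d → ℝ) → (Fin d → ℝ) := fun n x => b.symm^[n + 1] (u (R^[n] x)) with hs
  have hgeo : Summable fun n : ℕ => (1 / 2 : ℝ) ^ n * C :=
    (summable_geometric_of_lt_one (by norm_num) (by norm_num)).mul_right C
  have hsbd : ∀ n x, ‖s n x‖ ≤ (1 / 2 : ℝ) ^ n * C := fun n x => by
    refine (hbit _ _).trans (mul_le_mul ?_ (hC _) (norm_nonneg _) (by positivity))
    exact pow_le_pow_of_le_one (by norm_num) (by norm_num) (Nat.le_succ n)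
  have hsc : ∀ n, Continuous (s n) := fun n =>
    (hbc.iterate _).comp (huc.comp (hR.iterate n))
  have hssum : ∀ x, Summable fun n => s n x := fun x =>
    Summable.of_norm_bounded hgeo fun n => hsbd n x
  set w : (Fin d → ℝ) → (Fin d → ℝ) := fun x => ∑' n, s n x with hw
  have hwc : Continuous w := continuous_tsum hsc hgeo hsbd
  have hwper : ∀ x m, w (x + intVec m) = w x := fun x m => by
    simp only [hw]
    refine tsum_congr fun n => ?_
    obtain ⟨B', hB'⟩ := exists_iterate_equivariant hB n
    simp only [hs, hB', huper]
  obtain ⟨C', hC'⟩ := exists_bound_of_periodic hwc hwper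
  set h : (Fin d → ℝ) → (Fin d → ℝ) := fun x => x + w x with hh
  have hhB : ∀ x, realExt B (h x) = h (R x) := by
    intro x
    have h1 : realExt B (w x) = ∑' n, realExt B (s n x) :=
      ((⟨realExt B, continuous_realExt B⟩ : (Fin d → ℝ) →L[ℝ] (Fin d → ℝ))).map_tsum (hssum x)
    have h2 : ∀ n, realExt B (s n x) = b.symm^[n] (u (R^[n] x)) := fun n => by
      simp only [hs]
      rw [iterate_succ_apply', ← hbB, LinearEquiv.apply_symm_apply]
    have h3 : ∀ n, b.symm^[n + 1] (u (R^[n + 1] x)) = s n (R x) := fun n => by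
      simp only [hs, iterate_succ_apply]
    have h4 : Summable fun n => b.symm^[n] (u (R^[n] x)) := by
      rw [← summable_nat_add_iff 1]
      simpa only [h3] using hssum (R x)
    rw [hh, map_add, h1, tsum_congr h2, h4.tsum_eq_zero_add, tsum_congr h3]
    simp only [iterate_zero, id, hu, hw]
    abel
  have hhit : ∀ n x, h (R^[n] x) = (realExt B)^[n] (h x) := fun n => by
    induction n with
    | zero => exact fun x => rfl
    | succ n ih => intro x; rw [iterate_succ_apply, iterate_succ_apply, ih, hhB]
  have hhinj : Injective h := by
    intro x y hxy
    refine hsep x y (C' + C') fun n => ?_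
    have h1 : h (R^[n] x) = h (R^[n] y) := by rw [hhit, hhit, hxy]
    have h2 : R^[n] x - R^[n] y = w (R^[n] y) - w (R^[n] x) := by
      simp only [hh] at h1
      rw [sub_eq_sub_iff_add_eq_add, h1, add_comm]
    rw [h2]
    exact (norm_sub_le _ _).trans (add_le_add (hC' _) (hC' _))
  have hhper : ∀ x m, h (x + intVec m) = h x + intVec m := fun x m => by
    simp only [hh, hwper]; abel
  obtain ⟨H, hH⟩ := exists_descend (u := fun x => torusMk (h x))
    (continuous_torusMk.comp (continuous_id.add hwc)) fun x m => by
      rw [hhper, map_add, torusMk_intVec, add_zero]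
  refine ⟨H, fun x y hxy => ?_, fun v => ?_⟩
  · obtain ⟨x, rfl⟩ := torusMk_surjective x
    obtain ⟨y, rfl⟩ := torusMk_surjective y
    rw [hH, hH] at hxy
    obtain ⟨m, hm⟩ := torusMk_eq_iff.1 hxy
    rw [← hhper] at hm
    rw [hhinj hm, map_add, torusMk_intVec, add_zero]
  · rw [hH, hH, toralEnd_torusMk, hhB]

end Conjugacy

section Expanding

variable {d : ℕ} {B : (Fin d → ℤ) →+ (Fin d → ℤ)}

lemma iterate_toralEnd_torusMk (B : (Fin d → ℤ) →+ (Fin d → ℤ)) (n : ℕ) (v : Fin d → ℝ) :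
    (toralEnd B)^[n] (torusMk v) = torusMk ((realExt B ^ n) v) := by
  induction n with
  | zero => simp
  | succ n ih => rw [iterate_succ_apply', ih, toralEnd_torusMk, pow_succ', Module.End.mul_apply]

lemma norm_le_pow_of_expanding (hB : ∀ v, ‖v‖ ≤ 1 / 2 * ‖realExt B v‖) (n : ℕ) (v : Fin d → ℝ) :
    ‖v‖ ≤ (1 / 2) ^ n * ‖(realExt B ^ n) v‖ := by
  induction n with
  | zero => simp
  | succ n ih =>
    rw [pow_succ' (realExt B), Module.End.mul_apply, pow_succ, mul_assoc]
    exact ih.trans (by gcongr; exact hB _)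

lemma eq_zero_of_pow_fixed (hB : ∀ v, ‖v‖ ≤ 1 / 2 * ‖realExt B v‖) {n : ℕ} (hn : n ≠ 0)
    {v : Fin d → ℝ} (h : (realExt B ^ n) v = v) : v = 0 := by
  have h1 := norm_le_pow_of_expanding hB n v
  rw [h] at h1
  have h2 : (1 / 2 : ℝ) ^ n < 1 := pow_lt_one₀ (by norm_num) (by norm_num) hn
  have h3 := norm_nonneg v
  exact norm_eq_zero.1 (by nlinarith)

lemma injective_pow_realExt (hB : ∀ v, ‖v‖ ≤ 1 / 2 * ‖realExt B v‖) (n : ℕ) :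
    Injective (realExt B ^ n) :=
  (injective_iff_map_eq_zero _).2 fun v hv => by
    have h := norm_le_pow_of_expanding hB n v
    rw [hv, norm_zero, mul_zero] at h
    exact norm_le_zero_iff.1 h

lemma finite_ker_toralEnd (hB : ∀ v, ‖v‖ ≤ 1 / 2 * ‖realExt B v‖) :
    {x | toralEnd B x = 0}.Finite := by
  have hinj : Injective (realExt B) := by simpa using injective_pow_realExt hB 1
  obtain ⟨C, hC⟩ := (isCompact_Icc (a := (0 : Fin d → ℝ)) (b := 1)).exists_bound_of_continuousOn
    (continuous_realExt B).continuousOn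
  obtain ⟨N, hN⟩ := exists_nat_ge C
  have hfin : (Icc (fun _ => -(N : ℤ)) (fun _ => (N : ℤ)) : Set (Fin d → ℤ)).Finite :=
    Set.finite_Icc _ _
  refine (hfin.image fun m => torusMk (invFun (realExt B) (intVec m))).subset fun x hx => ?_
  obtain ⟨v, rfl⟩ := torusMk_surjective x
  obtain ⟨k, hk⟩ := exists_sub_intVec_mem_Icc v
  have hvk : torusMk (v - intVec k) = torusMk v := by simp
  rw [← hvk] at hx ⊢
  obtain ⟨m, hm⟩ := torusMk_eq_zero_iff.1 ((toralEnd_torusMk B _).symm.trans hx)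
  refine ⟨m, ?_, ?_⟩
  · have hi : ∀ i, |(m i : ℝ)| ≤ N := fun i => by
      have h := norm_le_pi_norm (intVec m) i
      rw [intVec_apply, Real.norm_eq_abs, ← hm] at h
      exact h.trans ((hC _ hk).trans hN)
    exact ⟨fun i => by exact_mod_cast (abs_le.1 (hi i)).1,
      fun i => by exact_mod_cast (abs_le.1 (hi i)).2⟩
  · simp only [← hm, leftInverse_invFun hinj _]

lemma countable_preperiodic (hB : ∀ v, ‖v‖ ≤ 1 / 2 * ‖realExt B v‖) :
    {x | ∃ n k, (toralEnd B)^[n + (k + 1)] x = (toralEnd B)^[n] x}.Countable := by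
  have hcover : {x | ∃ n k, (toralEnd B)^[n + (k + 1)] x = (toralEnd B)^[n] x} ⊆
      ⋃ q : ℕ × ℕ × (Fin d → ℤ), torusMk ''
        {v | (realExt B ^ (q.1 + (q.2.1 + 1))) v = (realExt B ^ q.1) v + intVec q.2.2} := by
    rintro x ⟨n, k, h⟩
    obtain ⟨v, rfl⟩ := torusMk_surjective x
    rw [iterate_toralEnd_torusMk, iterate_toralEnd_torusMk] at h
    obtain ⟨m, hm⟩ := torusMk_eq_iff.1 h
    exact mem_iUnion.2 ⟨(n, k, m), v, hm, rfl⟩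
  refine (countable_iUnion fun q => (Set.Subsingleton.countable ?_).image _).mono hcover
  intro v hv w hw
  have hv : (realExt B ^ (q.1 + (q.2.1 + 1))) v = (realExt B ^ q.1) v + intVec q.2.2 := hv
  have hw : (realExt B ^ (q.1 + (q.2.1 + 1))) w = (realExt B ^ q.1) w + intVec q.2.2 := hw
  have h : (realExt B ^ (q.2.1 + 1)) ((realExt B ^ q.1) (v - w)) = (realExt B ^ q.1) (v - w) := by
    rw [← Module.End.mul_apply, ← pow_add, add_comm _ q.1, map_sub, hv, hw, map_sub]
    abel
  have h0 := eq_zero_of_pow_fixed hB (Nat.succ_ne_zero _) h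
  rw [map_sub, sub_eq_zero] at h0
  exact injective_pow_realExt hB q.1 h0

/-- The functions satisfying an open condition uniformly on a compact set form an open set. -/
lemma isOpen_forall_mem_of_isCompact {Y Z : Type*} [TopologicalSpace Y] [TopologicalSpace Z]
    {Q : Set Z} (hQ : IsCompact Q) {W : Set (Y × Z)} (hW : IsOpen W) :
    IsOpen {f | ∀ z ∈ Q, (f, z) ∈ W} := by
  rw [isOpen_iff_mem_nhds]
  intro f hf
  have h := hQ.eventually_forall_of_forall_eventually (x₀ := f) (P := fun f z => (f, z) ∈ W)
    fun z hz => hW.mem_nhds (hf z hz)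
  exact h

end Expanding

section Perturbation

variable {d : ℕ}

lemma isOpen_forall_add_ne {K : Set (Fin d → UnitAddCircle)} (hK : K.Finite) :
    IsOpen {f : C(Fin d → UnitAddCircle, ℂ) | ∀ k ∈ K, ∀ x, f (x + k) ≠ f x} := by
  have h : {f : C(Fin d → UnitAddCircle, ℂ) | ∀ k ∈ K, ∀ x, f (x + k) ≠ f x} =
      ⋂ k ∈ K, {f | ∀ x ∈ (univ : Set (Fin d → UnitAddCircle)),
        (f, x) ∈ {q : C(Fin d → UnitAddCircle, ℂ) × (Fin d → UnitAddCircle) |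
          q.1 (q.2 + k) ≠ q.1 q.2}} := by
    ext f; simp
  rw [h]
  refine hK.isOpen_biInter fun k _ => isOpen_forall_mem_of_isCompact isCompact_univ ?_
  exact isOpen_ne_fun (by fun_prop) (by fun_prop)

/-- Some function separates every point from its translates by a given finite set. -/
lemma exists_forall_add_ne {K : Set (Fin d → UnitAddCircle)} (hK : K.Finite) :
    ∃ f : C(Fin d → UnitAddCircle, ℂ), ∀ k ∈ K, k ≠ 0 → ∀ x, f (x + k) ≠ f x := by
  suffices h : ∀ s : Finset (Fin d), ∃ f : C(Fin d → UnitAddCircle, ℂ),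
      (∀ k ∈ {k ∈ K | ∃ i ∈ s, k i ≠ 0}, ∀ x, f (x + k) ≠ f x) ∧
        ∀ k : Fin d → UnitAddCircle, (∀ i ∈ s, k i = 0) → ∀ x, f (x + k) = f x by
    obtain ⟨f, hf, -⟩ := h Finset.univ
    refine ⟨f, fun k hk hk0 => hf k ⟨hk, ?_⟩⟩
    obtain ⟨i, hi⟩ := Function.ne_iff.1 hk0
    exact ⟨i, Finset.mem_univ i, hi⟩
  intro s
  induction s using Finset.induction_on with
  | empty => exact ⟨0, by simp, by simp⟩
  | insert i s _ ih =>
    obtain ⟨f, hf, hf0⟩ := ih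
    set χ : C(Fin d → UnitAddCircle, ℂ) :=
      ⟨fun x => fourier 1 (x i), by fun_prop⟩ with hχ
    have hcont : Continuous fun c : ℂ => f + c • χ := by fun_prop
    have hev : ∀ᶠ c : ℂ in 𝓝 0,
        ∀ k ∈ {k ∈ K | ∃ i ∈ s, k i ≠ 0}, ∀ x, (f + c • χ) (x + k) ≠ (f + c • χ) x :=
      (hcont.tendsto 0).eventually ((isOpen_forall_add_ne (hK.subset (sep_subset _ _))).mem_nhds
        (by simpa using hf))
    obtain ⟨c, hc, hc0⟩ := ((hev.filter_mono nhdsWithin_le_nhds).and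
      (self_mem_nhdsWithin : {(0 : ℂ)}ᶜ ∈ 𝓝[≠] 0)).exists
    have hc0 : c ≠ 0 := hc0
    have hχadd : ∀ x k, χ (x + k) = χ x * χ k := fun x k => by
      simp [hχ, AddCircle.toCircle_add]
    have hχ0 : ∀ x, χ x ≠ 0 := fun x => by simp [hχ]
    refine ⟨f + c • χ, fun k hk x => ?_, fun k hk x => ?_⟩
    · by_cases hks : ∃ j ∈ s, k j ≠ 0
      · exact hc k ⟨hk.1, hks⟩ x
      · push Not at hks
        have hki : k i ≠ 0 := by
          obtain ⟨j, hj, hkj⟩ := hk.2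
          rcases Finset.mem_insert.1 hj with rfl | hj
          · exact hkj
          · exact absurd (hks j hj) hkj
        have hχk : χ k ≠ 1 := by
          intro h
          apply hki
          apply AddCircle.injective_toCircle one_ne_zero
          apply Circle.coe_injective
          simpa [hχ, fourier_one] using h
        simp only [ContinuousMap.add_apply, ContinuousMap.smul_apply, smul_eq_mul, hf0 k hks,
          hχadd, ne_eq, add_right_inj, mul_eq_mul_left_iff, mul_eq_left₀ (hχ0 x), hχk, hc0,
          or_self, not_false_eq_true]
    · have hχk : χ k = 1 := by simp [hχ, hk i (Finset.mem_insert_self i s)]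
      simp [hf0 k fun j hj => hk j (Finset.mem_insert_of_mem hj), hχadd, hχk]

lemma dense_apply_ne {X : Type*} [MetricSpace X] [CompactSpace X] {x y : X} (hxy : x ≠ y) :
    Dense {f : C(X, ℂ) | f x ≠ f y} := by
  intro f
  by_cases hf : f x = f y
  · set h : C(X, ℂ) := ⟨fun z => (dist z y : ℂ), by fun_prop⟩ with hh
    have hcont : Continuous fun c : ℂ => f + c • h := by fun_prop
    have ht : Filter.Tendsto (fun c : ℂ => f + c • h) (𝓝[≠] 0) (𝓝 f) := by
      simpa using (hcont.tendsto 0).mono_left nhdsWithin_le_nhds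
    refine mem_closure_of_tendsto ht ?_
    filter_upwards [self_mem_nhdsWithin] with c (hc : c ≠ 0)
    simp [hf, hh, hc, hxy]
  · exact subset_closure hf

lemma isOpen_apply_ne {X : Type*} [TopologicalSpace X] (x y : X) :
    IsOpen {f : C(X, ℂ) | f x ≠ f y} :=
  isOpen_ne_fun (by fun_prop) (by fun_prop)

/-- Two sequences with few coincidences take disjoint sets of values along many times. -/
lemma exists_finset_forall_ne {α : Type*} {a b : ℕ → α} (ha : Injective a)
    (hab : ∀ n, a n ≠ b n) (hb : ∀ j, {n | b n = a j}.Subsingleton) (M : ℕ) :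
    ∃ s : Finset ℕ, s.card = M ∧ ∀ i ∈ s, ∀ j ∈ s, a i ≠ b j := by
  induction M with
  | zero => exact ⟨∅, by simp⟩
  | succ M ih =>
    obtain ⟨s, hs, h⟩ := ih
    have hfin : ((s : Set ℕ) ∪ ⋃ j ∈ (s : Set ℕ), ({n | a n = b j} ∪ {n | b n = a j})).Finite := by
      refine s.finite_toSet.union (s.finite_toSet.biUnion fun j _ => Set.Finite.union ?_ ?_)
      · exact Set.Subsingleton.finite fun n hn m hm => ha (Eq.trans hn (Eq.symm hm))
      · exact (hb j).finite
    obtain ⟨n, hn⟩ := hfin.exists_notMem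
    simp only [mem_union, Finset.mem_coe, mem_iUnion, mem_ofPred_eq, not_or, not_exists] at hn
    refine ⟨insert n s, by simp [hn.1, hs], fun i hi j hj => ?_⟩
    rw [Finset.mem_insert] at hi hj
    rcases hi with rfl | hi <;> rcases hj with rfl | hj
    · exact hab _
    · exact (hn.2 j hj).1
    · exact fun h => (hn.2 i hi).2 h.symm
    · exact h i hi j hj

end Perturbation

section Observation

variable {d : ℕ} {B : (Fin d → ℤ) →+ (Fin d → ℤ)}

/-- Functions separating a set of pairs of orbits are dense if bumps along enough times are
available. -/
lemma dense_separating {ι : Type*} [Fintype ι] [DecidableEq ι] (hι : d < Fintype.card ι)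
    (n : ι → ℕ) (g : ι → C(Fin d → UnitAddCircle, ℂ))
    {Q : Set ((Fin d → UnitAddCircle) × (Fin d → UnitAddCircle))}
    (hx : ∀ z ∈ Q, ∀ j k, g j ((toralEnd B)^[n k] z.1) = if j = k then 1 else 0)
    (hy : ∀ z ∈ Q, ∀ j k, g j ((toralEnd B)^[n k] z.2) = 0) :
    Dense {f : C(Fin d → UnitAddCircle, ℂ) |
      ∀ z ∈ Q, ∃ m, f ((toralEnd B)^[m] z.1) ≠ f ((toralEnd B)^[m] z.2)} := by
  rw [Metric.dense_iff]
  intro f ε hε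
  obtain ⟨f₁, hf₁, hf₁f⟩ := exists_contDiff_near f (half_pos hε)
  set Ψ : (Fin d → ℝ) × (Fin d → ℝ) → (ι → ℂ) := fun q k =>
    f₁ (torusMk ((realExt B ^ n k) q.2)) - f₁ (torusMk ((realExt B ^ n k) q.1)) with hΨ
  have hsmooth : ContDiff ℝ 1 Ψ := by
    refine contDiff_pi.2 fun k => ?_
    have hlin : ContDiff ℝ 1 (realExt B ^ n k) :=
      (LinearMap.toContinuousLinearMap (realExt B ^ n k)).contDiff
    exact (hf₁.comp (hlin.comp contDiff_snd)).sub (hf₁.comp (hlin.comp contDiff_fst))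
  have hdense := hsmooth.dense_compl_range_of_finrank_lt_finrank (by
    rw [Module.finrank_pi_fintype]
    simp
    omega)
  have hcont : Continuous fun c : ι → ℂ => ∑ k, c k • g k := by fun_prop
  have hnear : {c : ι → ℂ | ‖∑ k, c k • g k‖ < ε / 2} ∈ 𝓝 0 :=
    (isOpen_lt hcont.norm continuous_const).mem_nhds (by
      have h0 : ∑ k, (0 : ι → ℂ) k • g k = 0 := Finset.sum_eq_zero fun k _ => zero_smul ℂ (g k)
      change ‖∑ k, (0 : ι → ℂ) k • g k‖ < ε / 2
      rw [h0, norm_zero]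
      exact half_pos hε)
  obtain ⟨c, hc, hcΨ⟩ := hdense.inter_nhds_nonempty hnear
  refine ⟨f₁ + ∑ k, c k • g k, ?_, fun z hz => ?_⟩
  · rw [mem_ball_iff_norm, add_sub_right_comm]
    exact (norm_add_le _ _).trans_lt (by
      have : ‖∑ k, c k • g k‖ < ε / 2 := hcΨ
      linarith)
  · by_contra! h
    obtain ⟨v, hv⟩ := torusMk_surjective z.1
    obtain ⟨w, hw⟩ := torusMk_surjective z.2
    refine hc ⟨(v, w), funext fun k => ?_⟩
    have hk := h (n k)
    simp only [ContinuousMap.add_apply, ContinuousMap.sum_apply, ContinuousMap.smul_apply,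
      hx z hz, hy z hz, smul_eq_mul, mul_ite, mul_one, mul_zero, Finset.sum_ite_eq',
      Finset.mem_univ, if_true, Finset.sum_const_zero, add_zero] at hk
    simp only [hΨ, ← iterate_toralEnd_torusMk, hv, hw]
    rw [← hk]
    ring

lemma isOpen_separating {b : (Fin d → UnitAddCircle) → (Fin d → UnitAddCircle)}
    (hb : Continuous b) {Q : Set ((Fin d → UnitAddCircle) × (Fin d → UnitAddCircle))}
    (hQ : IsCompact Q) :
    IsOpen {f : C(Fin d → UnitAddCircle, ℂ) | ∀ z ∈ Q, ∃ m, f (b^[m] z.1) ≠ f (b^[m] z.2)} := by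
  have hW : IsOpen {q : C(Fin d → UnitAddCircle, ℂ) ×
      ((Fin d → UnitAddCircle) × (Fin d → UnitAddCircle)) |
        ∃ m, q.1 (b^[m] q.2.1) ≠ q.1 (b^[m] q.2.2)} := by
    have h : {q : C(Fin d → UnitAddCircle, ℂ) ×
      ((Fin d → UnitAddCircle) × (Fin d → UnitAddCircle)) |
        ∃ m, q.1 (b^[m] q.2.1) ≠ q.1 (b^[m] q.2.2)} =
        ⋃ m, {q | q.1 (b^[m] q.2.1) ≠ q.1 (b^[m] q.2.2)} := by
      ext q; simp
    rw [h]
    refine isOpen_iUnion fun m => ?_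
    have hm := hb.iterate m
    exact isOpen_ne_fun (by fun_prop) (by fun_prop)
  exact isOpen_forall_mem_of_isCompact hQ hW

/-- A continuous function equal to `1` near `a` and to `0` away from `a`. -/
lemma exists_bump {X : Type*} [PseudoMetricSpace X] (a : X) {r : ℝ} (hr : 0 < r) :
    ∃ g : C(X, ℂ), (∀ z, dist z a ≤ r → g z = 1) ∧ ∀ z, 2 * r ≤ dist z a → g z = 0 := by
  refine ⟨⟨fun z => ((max 0 (min 1 (2 - dist z a / r)) : ℝ) : ℂ), by fun_prop⟩,
    fun z hz => ?_, fun z hz => ?_⟩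
  · have h : dist z a / r ≤ 1 := (div_le_one hr).2 hz
    have h2 : min 1 (2 - dist z a / r) = 1 := min_eq_left (by linarith)
    simp [h2]
  · have h : 2 ≤ dist z a / r := (le_div_iff₀ hr).2 hz
    have h2 : max 0 (min 1 (2 - dist z a / r)) = 0 :=
      max_eq_left ((min_le_right _ _).trans (by linarith))
    simp [h2]

/-- Near a pair of orbits that never meet, the first of which is not preperiodic, generic
functions separate. -/
lemma exists_nhds_dense_separating {x y : Fin d → UnitAddCircle}
    (hx : Injective fun n => (toralEnd B)^[n] x)
    (hxy : ∀ n, (toralEnd B)^[n] x ≠ (toralEnd B)^[n] y) :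
    ∃ Q ∈ 𝓝 (x, y), IsOpen {f : C(Fin d → UnitAddCircle, ℂ) |
      ∀ z ∈ Q, ∃ m, f ((toralEnd B)^[m] z.1) ≠ f ((toralEnd B)^[m] z.2)} ∧
      Dense {f : C(Fin d → UnitAddCircle, ℂ) |
      ∀ z ∈ Q, ∃ m, f ((toralEnd B)^[m] z.1) ≠ f ((toralEnd B)^[m] z.2)} := by
  set b := toralEnd B
  have hbc : ∀ n, Continuous b^[n] := fun n => (continuous_toralEnd B).iterate n
  have hcoin : ∀ j n l, b^[n] y = b^[j] x → b^[n + l] y = b^[j] x → l = 0 := by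
    intro j n l h1 h2
    rw [add_comm, iterate_add_apply, h1, ← iterate_add_apply] at h2
    have h3 := hx h2
    omega
  obtain ⟨s, hs, hne⟩ := exists_finset_forall_ne hx hxy (fun j n hn m hm => by
    rcases le_total n m with h | h
    · obtain ⟨l, rfl⟩ := Nat.exists_eq_add_of_le h
      rw [hcoin j n l hn hm, add_zero]
    · obtain ⟨l, rfl⟩ := Nat.exists_eq_add_of_le h
      rw [hcoin j m l hm hn, add_zero]) (d + 1)
  have hr : ∀ᶠ r : ℝ in 𝓝[>] 0, ∀ j k : s, (j ≠ k → 3 * r < dist (b^[k] x) (b^[j] x)) ∧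
      3 * r < dist (b^[k] y) (b^[j] x) := by
    have hlt : ∀ D : ℝ, 0 < D → ∀ᶠ r : ℝ in 𝓝[>] 0, 3 * r < D := fun D hD => by
      have hc : Continuous fun r : ℝ => 3 * r := by fun_prop
      exact ((hc.tendsto 0).mono_left nhdsWithin_le_nhds).eventually_lt_const (by simpa using hD)
    refine Filter.eventually_all.2 fun j => Filter.eventually_all.2 fun k => ?_
    refine Filter.Eventually.and ?_ (hlt _ (dist_pos.2 (hne j j.2 k k.2).symm))
    by_cases hjk : j = k
    · simp [hjk]
    · filter_upwards [hlt _ (dist_pos.2 fun h => hjk (Subtype.ext (hx h).symm))] with r hr _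
      exact hr
  obtain ⟨r, hr, hr0⟩ := (hr.and self_mem_nhdsWithin).exists
  have hr0 : 0 < r := hr0
  set Q : Set ((Fin d → UnitAddCircle) × (Fin d → UnitAddCircle)) :=
    ⋂ k : s, {z | dist (b^[k] z.1) (b^[k] x) ≤ r} ∩ {z | dist (b^[k] z.2) (b^[k] y) ≤ r} with hQ
  have hQ1 : ∀ z ∈ Q, ∀ k : s, dist (b^[k] z.1) (b^[k] x) ≤ r ∧ dist (b^[k] z.2) (b^[k] y) ≤ r :=
    fun z hz k => mem_iInter.1 hz k
  have hdc1 : ∀ k : ℕ, Continuous fun z : (Fin d → UnitAddCircle) × (Fin d → UnitAddCircle) =>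
      dist (b^[k] z.1) (b^[k] x) := fun k => by have := hbc k; fun_prop
  have hdc2 : ∀ k : ℕ, Continuous fun z : (Fin d → UnitAddCircle) × (Fin d → UnitAddCircle) =>
      dist (b^[k] z.2) (b^[k] y) := fun k => by have := hbc k; fun_prop
  have hQc : IsClosed Q := isClosed_iInter fun k =>
    (isClosed_le (hdc1 k) continuous_const).inter (isClosed_le (hdc2 k) continuous_const)
  have hQn : Q ∈ 𝓝 (x, y) := Filter.iInter_mem.2 fun k => Filter.inter_mem
    ((hdc1 k).tendsto (x, y) |>.eventually_le_const (by simpa using hr0))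
    ((hdc2 k).tendsto (x, y) |>.eventually_le_const (by simpa using hr0))
  choose g hg1 hg0 using fun k : s => exists_bump (b^[k] x) hr0
  refine ⟨Q, hQn, isOpen_separating (continuous_toralEnd B) hQc.isCompact,
    dense_separating (ι := s) (by simp [hs]) (fun k => k) g (fun z hz j k => ?_)
      fun z hz j k => hg0 j _ ?_⟩
  · split_ifs with hjk
    · subst hjk
      exact hg1 j _ (hQ1 z hz j).1
    · have h1 := dist_triangle_left (b^[k] x) (b^[j] x) (b^[k] z.1)
      exact hg0 j _ (by linarith [(hQ1 z hz k).1, (hr j k).1 hjk])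
  · have h1 := dist_triangle_left (b^[k] y) (b^[j] x) (b^[k] z.2)
    linarith [(hQ1 z hz k).2, (hr j k).2]

/-- An expanding toral endomorphism is observed by a complex-valued function. -/
lemma exists_observes_toralEnd (hB : ∀ v, ‖v‖ ≤ 1 / 2 * ‖realExt B v‖) :
    ∃ f : C(Fin d → UnitAddCircle, ℂ), ∀ x y, x ≠ y →
      ∃ n, f ((toralEnd B)^[n] x) ≠ f ((toralEnd B)^[n] y) := by
  set b := toralEnd B
  set P : Set (Fin d → UnitAddCircle) := {x | ∃ n k, b^[n + (k + 1)] x = b^[n] x}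
  have hP : P.Countable := countable_preperiodic hB
  have hinj : ∀ x ∉ P, Injective fun n => b^[n] x := by
    intro x hx n m h
    by_contra hnm
    rcases lt_or_gt_of_ne hnm with hlt | hlt
    · obtain ⟨k, rfl⟩ := Nat.exists_eq_add_of_lt hlt
      exact hx ⟨n, k, h.symm⟩
    · obtain ⟨k, rfl⟩ := Nat.exists_eq_add_of_lt hlt
      exact hx ⟨m, k, h⟩
  set S : Set ((Fin d → UnitAddCircle) × (Fin d → UnitAddCircle)) :=
    {z | z.1 ∉ P ∧ ∀ n, b^[n] z.1 ≠ b^[n] z.2}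
  have hloc : ∀ z : (Fin d → UnitAddCircle) × (Fin d → UnitAddCircle), ∃ Q, z ∈ S → Q ∈ 𝓝 z ∧
      IsOpen {f : C(Fin d → UnitAddCircle, ℂ) | ∀ z ∈ Q, ∃ m, f (b^[m] z.1) ≠ f (b^[m] z.2)} ∧
      Dense {f : C(Fin d → UnitAddCircle, ℂ) |
        ∀ z ∈ Q, ∃ m, f (b^[m] z.1) ≠ f (b^[m] z.2)} := by
    rintro ⟨x, y⟩
    by_cases hz : (x, y) ∈ S
    · obtain ⟨Q, h⟩ := exists_nhds_dense_separating (hinj x hz.1) hz.2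
      exact ⟨Q, fun _ => h⟩
    · exact ⟨∅, fun h => absurd h hz⟩
  choose Q hQ using hloc
  obtain ⟨t, htS, htc, hcov⟩ := TopologicalSpace.countable_cover_nhdsWithin
    (f := Q) (s := S) fun z hz => mem_nhdsWithin_of_mem_nhds (hQ z hz).1
  have hdense1 := dense_biInter_of_isOpen (fun z hz => (hQ z (htS hz)).2.1) htc
    fun z hz => (hQ z (htS hz)).2.2
  have hopen1 : IsGδ (⋂ z ∈ t, {f : C(Fin d → UnitAddCircle, ℂ) |
      ∀ w ∈ Q z, ∃ m, f (b^[m] w.1) ≠ f (b^[m] w.2)}) :=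
    IsGδ.biInter htc fun z hz => (hQ z (htS hz)).2.1.isGδ
  have hoff : (P ×ˢ P ∩ {z | z.1 ≠ z.2}).Countable := (hP.prod hP).mono inter_subset_left
  have hdense2 : Dense (⋂ z ∈ P ×ˢ P ∩ {z | z.1 ≠ z.2},
      {f : C(Fin d → UnitAddCircle, ℂ) | f z.1 ≠ f z.2}) :=
    dense_biInter_of_isOpen (fun z _ => isOpen_apply_ne z.1 z.2) hoff
      fun z hz => dense_apply_ne hz.2
  have hopen2 : IsGδ (⋂ z ∈ P ×ˢ P ∩ {z | z.1 ≠ z.2},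
      {f : C(Fin d → UnitAddCircle, ℂ) | f z.1 ≠ f z.2}) :=
    IsGδ.biInter hoff fun z _ => (isOpen_apply_ne z.1 z.2).isGδ
  set K : Set (Fin d → UnitAddCircle) := {k | b k = 0} \ {0}
  have hK : K.Finite := (finite_ker_toralEnd hB).subset sdiff_subset
  obtain ⟨f₀, hf₀⟩ := exists_forall_add_ne hK
  obtain ⟨f, hf, hf1, hf2⟩ := (hdense1.inter_of_Gδ hopen1 hopen2 hdense2).inter_open_nonempty _
    (isOpen_forall_add_ne hK) ⟨f₀, fun k hk => hf₀ k hk hk.2⟩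
  have hS : ∀ z ∈ S, ∃ m, f (b^[m] z.1) ≠ f (b^[m] z.2) := fun z hz => by
    obtain ⟨w, hwt, hzw⟩ := mem_iUnion₂.1 (hcov hz)
    exact mem_iInter₂.1 hf1 w hwt z hzw
  refine ⟨f, fun x y hxy => ?_⟩
  by_cases hcoal : ∃ n, b^[n] x = b^[n] y
  · classical
    obtain ⟨l, hl⟩ : ∃ l, Nat.find hcoal = l + 1 := Nat.exists_eq_succ_of_ne_zero fun h =>
      hxy (by simpa [h] using Nat.find_spec hcoal)
    have h1 : b^[l + 1] x = b^[l + 1] y := hl ▸ Nat.find_spec hcoal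
    have h2 : b^[l] x ≠ b^[l] y := Nat.find_min hcoal (by omega)
    have h3 : b^[l] x - b^[l] y ∈ K := by
      refine ⟨?_, fun h => h2 (sub_eq_zero.1 h)⟩
      rw [iterate_succ_apply', iterate_succ_apply'] at h1
      exact (map_sub b _ _).trans (sub_eq_zero.2 h1)
    have h4 := hf _ h3 (b^[l] y)
    rw [add_sub_cancel] at h4
    exact ⟨l, h4⟩
  · push Not at hcoal
    by_cases hx : x ∈ P
    · by_cases hy : y ∈ P
      · exact ⟨0, mem_iInter₂.1 hf2 (x, y) ⟨⟨hx, hy⟩, hxy⟩⟩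
      · obtain ⟨m, hm⟩ := hS (y, x) ⟨hy, fun n => (hcoal n).symm⟩
        exact ⟨m, hm.symm⟩
    · exact hS (x, y) ⟨hx, hcoal⟩

end Observation

section Assembly

variable {d : ℕ} {T : (Fin d → UnitAddCircle) → (Fin d → UnitAddCircle)}

lemma torusMk_iterate {F : (Fin d → ℝ) → (Fin d → ℝ)} (hF : ∀ x, torusMk (F x) = T (torusMk x))
    (n : ℕ) (x : Fin d → ℝ) : torusMk (F^[n] x) = T^[n] (torusMk x) :=
  Semiconj.iterate_right (f := torusMk) hF n x

/-- Expansivity of a torus map lifts to the universal cover. -/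
lemma expansive_lift {δ : ℝ}
    (hexp : ∀ x y, x ≠ y → ∃ n : ℕ, δ < dist (T^[n] x) (T^[n] y))
    {F : (Fin d → ℝ) → (Fin d → ℝ)} (hF : ∀ x, torusMk (F x) = T (torusMk x)) {x y : Fin d → ℝ}
    (h : ∀ n, ‖F^[n] x - F^[n] y‖ ≤ min δ (1 / 2)) : x = y := by
  by_contra hxy
  have hp : torusMk x ≠ torusMk y := fun hp => by
    have h0 := norm_sub_le_dist_torusMk ((h 0).trans (min_le_right _ _))
    rw [iterate_zero_apply, iterate_zero_apply, hp, dist_self, norm_le_zero_iff, sub_eq_zero] at h0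
    exact hxy h0
  obtain ⟨n, hn⟩ := hexp _ _ hp
  rw [← torusMk_iterate hF, ← torusMk_iterate hF] at hn
  exact absurd (hn.trans_le (dist_torusMk_le _ _)) (not_lt.2 ((h n).trans (min_le_left _ _)))

/-- A toral map with an expanding lift is observed by a complex-valued function. -/
lemma exists_observes_of_contracting [NeZero d]
    {F : (Fin d → ℝ) ≃ₜ (Fin d → ℝ)} (hF : ∀ x, torusMk (F x) = T (torusMk x))
    {A : (Fin d → ℤ) →+ (Fin d → ℤ)} (hA : ∀ x m, F (x + intVec m) = F x + intVec (A m))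
    (hcontr : ∀ ε > 0, ∃ N, ∀ j ≥ N, ∀ a b, ‖F.symm^[j] a - F.symm^[j] b‖ ≤ ε * (‖a - b‖ + 1)) :
    ∃ f : C(Fin d → UnitAddCircle, ℂ), ∀ x y, x ≠ y → ∃ n, f (T^[n] x) ≠ f (T^[n] y) := by
  obtain ⟨j, B, hB, hBexp⟩ := exists_iterate_expanding hA hcontr
  have hj : 1 ≤ j := by
    by_contra! hj
    obtain rfl : j = 0 := by omega
    have h1 : B 1 = 1 := intVec_injective (by simpa using (hB 0 1).symm)
    have h2 := hBexp (intVec 1)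
    rw [realExt_intVec, h1] at h2
    have h3 := norm_intVec_ge (m := (1 : Fin d → ℤ)) one_ne_zero
    linarith
  obtain ⟨H, hH, hconj⟩ := exists_injective_conj_toralEnd (F.continuous.iterate j) hB hBexp
    fun x y C hC => by
      have hC0 : 0 ≤ C := (norm_nonneg _).trans (hC 0)
      refine sub_eq_zero.1 (norm_le_zero_iff.1 (le_of_forall_pos_le_add fun ε hε => ?_))
      obtain ⟨N, hN⟩ := hcontr (ε / (C + 1)) (by positivity)
      have h := norm_sub_le_of_contracting hN (Nat.le_mul_of_pos_left N hj) x y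
      rw [iterate_mul] at h
      calc ‖x - y‖ ≤ ε / (C + 1) * (C + 1) := h.trans (by gcongr; exact hC N)
        _ = 0 + ε := by field_simp; ring
  obtain ⟨f, hf⟩ := exists_observes_toralEnd hBexp
  have hsemi : ∀ x, H (T^[j] x) = toralEnd B (H x) := fun x => by
    obtain ⟨v, rfl⟩ := torusMk_surjective x
    rw [← torusMk_iterate hF, hconj]
  refine ⟨f.comp H, fun x y hxy => ?_⟩
  obtain ⟨n, hn⟩ := hf (H x) (H y) (hH.ne hxy)
  refine ⟨j * n, ?_⟩
  rw [iterate_mul]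
  rwa [← Semiconj.iterate_right (f := H) hsemi n x,
    ← Semiconj.iterate_right (f := H) hsemi n y] at hn

end Assembly

/-- Every positively expansive continuous map of the torus `𝕋^d` (`d ≥ 1`) has
observability number 2: some continuous `f : 𝕋^d → ℝ²` observes it, but no continuous
`f : 𝕋^d → ℝ` does. -/
theorem stmt10 (d : ℕ) (hd : 1 ≤ d)
    (T : (Fin d → UnitAddCircle) → (Fin d → UnitAddCircle))
    (hTcont : Continuous T)
    (hexp : ∃ δ : ℝ, 0 < δ ∧ ∀ x y : Fin d → UnitAddCircle, x ≠ y →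
      ∃ n : ℕ, δ < dist (T^[n] x) (T^[n] y)) :
    obsNum T = 2 ∧
      (∃ f : C(Fin d → UnitAddCircle, EuclideanSpace ℝ (Fin 2)),
        ∀ x y : Fin d → UnitAddCircle, x ≠ y →
          ∃ n : ℕ, f (T^[n] x) ≠ f (T^[n] y)) ∧
      (∀ f : C(Fin d → UnitAddCircle, ℝ),
        ¬ (∀ x y : Fin d → UnitAddCircle, x ≠ y →
          ∃ n : ℕ, f (T^[n] x) ≠ f (T^[n] y))) := by
  have : NeZero d := ⟨by omega⟩
  obtain ⟨δ, hδ, hexp⟩ := hexp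
  obtain ⟨F, hF, A, hA⟩ := exists_homeomorph_lift hTcont hδ hexp
  have hcontr : ∀ ε > 0, ∃ N, ∀ j ≥ N, ∀ a b,
      ‖F.symm^[j] a - F.symm^[j] b‖ ≤ ε * (‖a - b‖ + 1) := fun ε hε =>
    exists_contracting_symm hA (α := min δ (1 / 2)) (by positivity)
      ((min_le_right _ _).trans (by norm_num)) (fun x y h => expansive_lift hexp hF h) hε
  have hreal : ∀ f : C(Fin d → UnitAddCircle, ℝ),
      ¬ ∀ x y, x ≠ y → ∃ n : ℕ, f (T^[n] x) ≠ f (T^[n] y) := fun f =>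
    exists_not_observed_real hF hA (not_surjective_of_contracting hA hcontr) f
  obtain ⟨f, hf⟩ := exists_observes_of_contracting hF hA hcontr
  have hplane : ∃ f : C(Fin d → UnitAddCircle, EuclideanSpace ℝ (Fin 2)),
      ∀ x y, x ≠ y → ∃ n : ℕ, f (T^[n] x) ≠ f (T^[n] y) :=
    ⟨⟨fun x => Complex.orthonormalBasisOneI.repr (f x), by fun_prop⟩, fun x y hxy =>
      (hf x y hxy).imp fun n hn h => hn (Complex.orthonormalBasisOneI.repr.injective h)⟩
  refine ⟨le_antisymm (sInf_le ⟨2, rfl, by norm_num, hplane⟩) (le_sInf ?_), hplane, hreal⟩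
  rintro _ ⟨k, rfl, hk, g, hg⟩
  rcases hk.eq_or_lt with rfl | hk
  · refine (hreal ⟨fun x => g x 0, by fun_prop⟩ fun x y hxy =>
      (hg x y hxy).imp fun n hn h => hn ?_).elim
    ext i
    rw [Subsingleton.elim i 0]
    exact h
  · exact_mod_cast hk
end

section
/- Let T : X → X be an expansive homeomorphism of a compact metric space X. If f ∈ C(X, ℝ^m) observes T, then f strictly bilaterally observes T, i.e., there exists ε > 0 such that for all x ≠ y there is n ∈ ℤ with ‖f(T^n x) − f(T^n y)‖ > ε. -/
open Set Topology Function

/-- If countably many continuous maps jointly separate the points of every pair in a compact set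
of pairs, then some positive gap works uniformly over that set. -/
theorem exists_uniform_gap_of_isCompact {X Y : Type*} [TopologicalSpace X]
    [SeminormedAddCommGroup Y] {g : ℕ → X → Y} (hg : ∀ n, Continuous (g n))
    {K : Set (X × X)} (hK : IsCompact K) (hsep : ∀ p ∈ K, ∃ n, 0 < ‖g n p.1 - g n p.2‖) :
    ∃ ε : ℝ, 0 < ε ∧ ∀ p ∈ K, ∃ n, ε < ‖g n p.1 - g n p.2‖ := by
  let V : ℕ → Set (X × X) := fun k => ⋃ n, {p | 1 / ((k : ℝ) + 1) < ‖g n p.1 - g n p.2‖}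
  have hopen : ∀ k, IsOpen (V k) := fun k => isOpen_iUnion fun n =>
    isOpen_lt continuous_const
      (((hg n).comp continuous_fst).sub ((hg n).comp continuous_snd)).norm
  have hcover : K ⊆ ⋃ k, V k := by
    intro p hp
    obtain ⟨n, hn⟩ := hsep p hp
    obtain ⟨k, hk⟩ := exists_nat_one_div_lt hn
    exact mem_iUnion.2 ⟨k, mem_iUnion.2 ⟨n, hk⟩⟩
  have hmono : Monotone V := fun a b hab => iUnion_mono fun n =>
    ofPred_subset_ofPred.2 fun p hp => (Nat.one_div_le_one_div hab).trans_lt hp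
  obtain ⟨k, hk⟩ := hK.elim_directed_cover V hopen hcover hmono.directed_le
  exact ⟨1 / ((k : ℝ) + 1), Nat.one_div_pos_of_nat, fun p hp => mem_iUnion.1 (hk hp)⟩

/-- If `T` is an expansive homeomorphism of a compact metric space and `f ∈ C(X, ℝ^m)`
observes `T`, then `f` strictly bilaterally observes `T`. -/
theorem stmt11 {X : Type*} [MetricSpace X] [CompactSpace X]
    (T : X ≃ₜ X)
    (hexp : ∃ δ : ℝ, 0 < δ ∧ ∀ x y : X, x ≠ y →
      ∃ n : ℤ, δ < dist ((T.toEquiv ^ n) x) ((T.toEquiv ^ n) y))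
    (m : ℕ) (f : C(X, EuclideanSpace ℝ (Fin m)))
    (hobs : ∀ x y : X, x ≠ y → ∃ n : ℕ, f ((⇑T)^[n] x) ≠ f ((⇑T)^[n] y)) :
    ∃ ε : ℝ, 0 < ε ∧ ∀ x y : X, x ≠ y →
      ∃ n : ℤ, ε < ‖f ((T.toEquiv ^ n) x) - f ((T.toEquiv ^ n) y)‖ := by
  obtain ⟨δ, hδ, hexp⟩ := hexp
  have hK : IsCompact {p : X × X | δ ≤ dist p.1 p.2} :=
    (isClosed_le continuous_const continuous_dist).isCompact
  obtain ⟨ε, hε, h⟩ := exists_uniform_gap_of_isCompact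
    (g := fun n x => f ((⇑T)^[n] x)) (fun n => f.continuous.comp (T.continuous.iterate n)) hK
    (fun p hp => by
      obtain ⟨n, hn⟩ := hobs p.1 p.2 (dist_pos.1 (hδ.trans_le hp))
      exact ⟨n, norm_pos_iff.2 (sub_ne_zero.2 hn)⟩)
  refine ⟨ε, hε, fun x y hxy => ?_⟩
  obtain ⟨N, hN⟩ := hexp x y hxy
  obtain ⟨n, hn⟩ := h ((T.toEquiv ^ N) x, (T.toEquiv ^ N) y) hN.le
  have hiter : ∀ z, (T.toEquiv ^ ((n : ℤ) + N)) z = (⇑T)^[n] ((T.toEquiv ^ N) z) := by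
    intro z
    rw [zpow_add, zpow_natCast, Equiv.Perm.mul_apply, ← Equiv.Perm.iterate_eq_pow]
    rfl
  refine ⟨n + N, ?_⟩
  rwa [hiter, hiter]
end

section
/- Let T : X → X be a homeomorphism of a compact metric space X and let m ≥ 1. The following are equivalent: (1) T is expansive; (2) the set of f ∈ C(X, ℝ^m) that strictly bilaterally observe T is residual (comeager); (3) there exists f ∈ C(X, ℝ^m) that strictly bilaterally observes T. -/
open Set Topology Function

/-- Frink's metrization argument: a sequence of relations with `U (n + 1) ○ U (n + 1) ○ U (n + 1)`
contained in `U n` and with trivial intersection is dominated by a family of functions which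
separates points. -/
theorem exists_separating_of_comp_subset {X : Type*} (U : ℕ → X → X → Prop)
    (hrefl : ∀ n x, U n x x) (hsymm : ∀ n x y, U n x y → U n y x)
    (hanti : ∀ m n x y, m ≤ n → U n x y → U m x y)
    (hcomp : ∀ n a b c d, U (n + 1) a b → U (n + 1) b c → U (n + 1) c d → U n a d)
    (hsep : ∀ x y, (∀ n, U n x y) → x = y) {x y : X} (hxy : x ≠ y) :
    ∃ φ : X → ℝ, φ x ≠ φ y ∧ ∀ n a b, U n a b → |φ a - φ b| ≤ (1 / 2) ^ n := by
  classical
  have hsymm' : ∀ n x y, U n x y ↔ U n y x := fun n x y => ⟨hsymm n x y, hsymm n y x⟩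
  set d : X → X → NNReal := fun x y => if h : ∃ n, ¬ U n x y then (1 / 2) ^ Nat.find h else 0
    with hd
  have hd_self : ∀ x, d x x = 0 := fun x => dif_neg (by simp [hrefl])
  have hd_symm : ∀ x y, d x y = d y x := fun x y => by simp only [hd, hsymm' _ x y]
  have hr : (1 / 2 : NNReal) ∈ Ioo (0 : NNReal) 1 :=
    ⟨half_pos one_pos, NNReal.half_lt_self one_ne_zero⟩
  have hle_d : ∀ {x y : X} {n : ℕ}, (1 / 2) ^ n ≤ d x y ↔ ¬ U n x y := by
    intro x y n
    dsimp only [d]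
    split_ifs with h
    · rw [(pow_right_strictAnti₀ hr.1 hr.2).le_iff_ge, Nat.find_le_iff]
      exact ⟨fun ⟨m, hmn, hm⟩ hn => hm (hanti _ _ _ _ hmn hn), fun h => ⟨n, le_rfl, h⟩⟩
    · push Not at h
      simp only [h, not_true, (pow_pos hr.1 _).not_ge]
  have hd_le := PseudoMetricSpace.le_two_mul_dist_ofPreNNDist d hd_self hd_symm
    fun x₁ x₂ x₃ x₄ => by
      by_cases H : ∃ n, ¬ U n x₁ x₄
      · refine (dif_pos H).trans_le ?_
        rw [← div_le_iff₀' zero_lt_two, ← mul_one_div (_ ^ _), ← pow_succ]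
        simp only [le_max_iff, hle_d, ← not_and_or]
        rintro ⟨h₁₂, h₂₃, h₃₄⟩
        exact Nat.find_spec H (hcomp _ _ _ _ _ h₁₂ h₂₃ h₃₄)
      · exact (dif_neg H).trans_le zero_le
  have hdist_le := PseudoMetricSpace.dist_ofPreNNDist_le d hd_self hd_symm
  let I := PseudoMetricSpace.ofPreNNDist d hd_self hd_symm
  refine ⟨fun z => dist x z, ?_, fun n a b hab => ?_⟩
  · have hpos : 0 < d x y := by
      obtain ⟨n, hn⟩ : ∃ n, ¬ U n x y := by
        by_contra! h
        exact hxy (hsep x y h)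
      exact (pow_pos hr.1 n).trans_le (hle_d.2 hn)
    have h1 : (d x y : ℝ) ≤ 2 * dist x y := hd_le x y
    have h2 : (0 : ℝ) < d x y := by exact_mod_cast hpos
    have h3 : dist x x = 0 := dist_self x
    intro h
    simp only [h3] at h
    linarith
  · have h1 : dist a b ≤ d a b := hdist_le a b
    have h2 : d a b < (1 / 2) ^ n := by
      by_contra! h
      exact hle_d.1 h hab
    have h3 : (d a b : ℝ) ≤ (1 / 2) ^ n := by exact_mod_cast h2.le
    have h4 : |dist x a - dist x b| ≤ dist a b := by
      have := abs_dist_sub_le a b x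
      rwa [dist_comm a x, dist_comm b x] at this
    exact h4.trans (h1.trans h3)

open MeasureTheory in
/-- Finitely many boxes pulled back by affine maps do not cover a cube of larger volume. -/
theorem exists_forall_exists_lt_abs_of_volume_lt {Q : Type*} [Fintype Q] {k : ℕ}
    (b : Q → Fin k → ℝ) (A : Q → Matrix (Fin k) (Fin k) ℝ) {d₀ t η : ℝ} (hd₀ : 0 < d₀)
    (hA : ∀ q, d₀ ≤ |(A q).det|) (hη : 0 ≤ η) (ht : 0 ≤ t)
    (h : Fintype.card Q * (d₀⁻¹ * (2 * t) ^ k) < (2 * η) ^ k) :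
    ∃ v : Fin k → ℝ, (∀ i, |v i| ≤ η) ∧ ∀ q, ∃ j, t < |b q j + (A q).mulVec v j| := by
  by_contra! hcon
  let S : Q → Set (Fin k → ℝ) := fun q =>
    Matrix.toLin' (A q) ⁻¹' Icc (fun j => -b q j - t) (fun j => -b q j + t)
  have hsub : Icc (fun _ : Fin k => -η) (fun _ => η) ⊆ ⋃ q, S q := by
    intro v hv
    obtain ⟨q, hq⟩ := hcon v fun i => abs_le.2 ⟨hv.1 i, hv.2 i⟩
    refine mem_iUnion.2 ⟨q, ?_, ?_⟩ <;> intro j <;> have := abs_le.1 (hq j) <;>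
      simp only [Matrix.toLin'_apply] <;> linarith
  have hvol : ∀ q, volume (S q) ≤ ENNReal.ofReal (d₀⁻¹ * (2 * t) ^ k) := by
    intro q
    have hne : LinearMap.det (Matrix.toLin' (A q)) ≠ 0 := by
      rw [LinearMap.det_toLin']
      exact abs_pos.1 (hd₀.trans_le (hA q))
    rw [Measure.addHaar_preimage_linearMap _ hne, Real.volume_Icc_pi, LinearMap.det_toLin']
    have : ∀ j, (-b q j + t) - (-b q j - t) = 2 * t := fun j => by ring
    simp only [this, Finset.prod_const, Finset.card_univ, Fintype.card_fin]
    rw [← ENNReal.ofReal_pow (by positivity), ← ENNReal.ofReal_mul (by positivity)]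
    refine ENNReal.ofReal_le_ofReal ?_
    rw [abs_inv]
    gcongr
    exact hA q
  have h1 : ENNReal.ofReal ((2 * η) ^ k) ≤
      ENNReal.ofReal (Fintype.card Q * (d₀⁻¹ * (2 * t) ^ k)) := by
    calc ENNReal.ofReal ((2 * η) ^ k)
        = volume (Icc (fun _ : Fin k => -η) (fun _ => η)) := by
          rw [Real.volume_Icc_pi, ENNReal.ofReal_pow (by positivity)]
          simp [two_mul]
      _ ≤ volume (⋃ q, S q) := measure_mono hsub
      _ ≤ ∑ q, volume (S q) := measure_iUnion_fintype_le _ _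
      _ ≤ ∑ _q : Q, ENNReal.ofReal (d₀⁻¹ * (2 * t) ^ k) := Finset.sum_le_sum fun q _ => hvol q
      _ = _ := by
          rw [Finset.sum_const, nsmul_eq_mul, ENNReal.ofReal_mul (Nat.cast_nonneg _),
            ENNReal.ofReal_natCast, Finset.card_univ]
  rw [ENNReal.ofReal_le_ofReal_iff (by positivity)] at h1
  linarith

/-- A quantitative transversality statement: an affine family whose index set is covered by at
most `C * R ^ n` pieces of size `2 ^ (-n)` omits the value `0` for some small parameter as soon as
the number of parameters is large compared to `R`. -/
theorem exists_small_forall_add_mulVec_ne_zero {Z : Type*} {k : ℕ} (F : Z → Fin k → ℝ)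
    (A : Z → Matrix (Fin k) (Fin k) ℝ) {d₀ C R L : ℝ} (hd₀ : 0 < d₀)
    (hA : ∀ z, d₀ ≤ |(A z).det|) (hR : 0 ≤ R) (hRk : R < 2 ^ k) (hL : 0 ≤ L)
    (hcol : ∀ n : ℕ, ∃ (Q : Type) (_ : Fintype Q) (col : Z → Q),
      (Fintype.card Q : ℝ) ≤ C * R ^ n ∧ ∀ z z', col z = col z' →
        (∀ j, |F z j - F z' j| ≤ L * (1 / 2) ^ n) ∧
        ∀ j i, |A z j i - A z' j i| ≤ L * (1 / 2) ^ n)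
    {η : ℝ} (hη : 0 < η) :
    ∃ v : Fin k → ℝ, (∀ i, |v i| ≤ η) ∧ ∀ z, F z + (A z).mulVec v ≠ 0 := by
  classical
  set c : ℝ := L * (1 + k * η) with hc
  have hc0 : 0 ≤ c := by positivity
  obtain ⟨n, hn⟩ : ∃ n : ℕ, C * d₀⁻¹ * (2 * c) ^ k * (R / 2 ^ k) ^ n < (2 * η) ^ k := by
    have hlim : Filter.Tendsto (fun n : ℕ => C * d₀⁻¹ * (2 * c) ^ k * (R / 2 ^ k) ^ n)
        Filter.atTop (𝓝 (C * d₀⁻¹ * (2 * c) ^ k * 0)) :=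
      (tendsto_pow_atTop_nhds_zero_of_lt_one (by positivity)
        ((div_lt_one (by positivity)).2 hRk)).const_mul _
    rw [mul_zero] at hlim
    exact (hlim.eventually_lt_const (by positivity)).exists
  obtain ⟨Q, _, col, hcard, hclose⟩ := hcol n
  let rep : range col → Z := fun q => q.2.choose
  have hrep : ∀ q, col (rep q) = q := fun q => q.2.choose_spec
  have hcard' : (Fintype.card (range col) : ℝ) ≤ C * R ^ n :=
    le_trans (by exact_mod_cast Fintype.card_subtype_le _) hcard
  obtain ⟨v, hv, hv'⟩ := exists_forall_exists_lt_abs_of_volume_lt (fun q => F (rep q))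
    (fun q => A (rep q)) (t := c * (1 / 2) ^ n) hd₀ (fun q => hA _) hη.le (by positivity) (by
      refine lt_of_le_of_lt ?_ hn
      calc (Fintype.card (range col) : ℝ) * (d₀⁻¹ * (2 * (c * (1 / 2) ^ n)) ^ k)
          ≤ C * R ^ n * (d₀⁻¹ * (2 * (c * (1 / 2) ^ n)) ^ k) := by gcongr
        _ = _ := by
            rw [← mul_assoc 2 c, mul_pow (2 * c), ← pow_mul, mul_comm n k, pow_mul, div_pow,
              div_pow, one_pow]
            ring)
  refine ⟨v, hv, fun z hz => ?_⟩
  obtain ⟨j, hj⟩ := hv' ⟨col z, z, rfl⟩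
  obtain ⟨hF, hM⟩ := hclose (rep ⟨col z, z, rfl⟩) z (hrep _)
  set w := rep ⟨col z, z, rfl⟩
  have hzj : F z j + (A z).mulVec v j = 0 := congrFun hz j
  refine hj.not_ge ?_
  have h1 : F w j + (A w).mulVec v j = (F w j - F z j) + ∑ i, (A w j i - A z j i) * v i := by
    have : ∑ i, (A w j i - A z j i) * v i = (A w).mulVec v j - (A z).mulVec v j := by
      simp [Matrix.mulVec, dotProduct, sub_mul]
    rw [this]
    linarith
  rw [h1]
  calc |(F w j - F z j) + ∑ i, (A w j i - A z j i) * v i|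
      ≤ |F w j - F z j| + ∑ i, |(A w j i - A z j i) * v i| :=
        (abs_add_le _ _).trans (by gcongr; exact Finset.abs_sum_le_sum_abs _ _)
    _ ≤ L * (1 / 2) ^ n + ∑ _i : Fin k, L * (1 / 2) ^ n * η := by
        gcongr with i
        · exact hF j
        · rw [abs_mul]
          gcongr
          · exact hM j i
          · exact hv i
    _ = c * (1 / 2) ^ n := by
        simp [hc]
        ring

/-- A decreasing sequence of neighbourhoods of the diagonal, adapted to `E`, which is fast enough
for Frink's metrization argument and whose members can be coded by `P ^ n` symbols. -/
structure IsAdaptedFiltration {X : Type*} [TopologicalSpace X] (E : Equiv.Perm X)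
    (U : ℕ → X → X → Prop) (P : ℝ) : Prop where
  refl : ∀ n x, U n x x
  symm : ∀ n x y, U n x y → U n y x
  anti : ∀ m n x y, m ≤ n → U n x y → U m x y
  comp : ∀ n a b c d, U (n + 1) a b → U (n + 1) b c → U (n + 1) c d → U n a d
  sep : ∀ x y, (∀ n, U n x y) → x = y
  nhds : ∀ n x, ∀ᶠ y in 𝓝 x, U n x y
  shift : ∀ (i : ℤ) (n s : ℕ) (x y : X), i.natAbs ≤ s → U (n + s) x y →
    U n ((E ^ i) x) ((E ^ i) y)
  nonneg : 0 ≤ P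
  code : ∀ n, ∃ (Q : Type) (_ : Fintype Q) (code : X → Q), (Fintype.card Q : ℝ) ≤ P ^ n ∧
    ∀ x y, code x = code y → U n x y

/-- The orbits of `x` and `y` remain `δ`-close for all times of absolute value less than `n`. -/
def OrbitClose {X : Type*} [MetricSpace X] (E : Equiv.Perm X) (δ : ℝ) (n : ℕ) (x y : X) : Prop :=
  ∀ i : ℤ, i.natAbs < n → dist ((E ^ i) x) ((E ^ i) y) ≤ δ

theorem OrbitClose.shift {X : Type*} [MetricSpace X] {E : Equiv.Perm X} {δ : ℝ} {n s : ℕ} {x y : X}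
    (h : OrbitClose E δ (n + s) x y) {i : ℤ} (hi : i.natAbs ≤ s) :
    OrbitClose E δ n ((E ^ i) x) ((E ^ i) y) := by
  intro j hj
  have := h (j + i) (by omega)
  rwa [zpow_add] at this

theorem OrbitClose.exists_dist_le {X : Type*} [MetricSpace X] [CompactSpace X] {E : Equiv.Perm X}
    (hE : ∀ n : ℤ, Continuous (E ^ n)) {δ : ℝ}
    (hexp : ∀ x y : X, x ≠ y → ∃ n : ℤ, δ < dist ((E ^ n) x) ((E ^ n) y)) {η : ℝ} (hη : 0 < η) :
    ∃ M : ℕ, 1 ≤ M ∧ ∀ x y : X, OrbitClose E δ M x y → dist x y ≤ η := by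
  have hK : IsCompact {z : X × X | η ≤ dist z.1 z.2} :=
    (isClosed_le continuous_const (by fun_prop)).isCompact
  obtain ⟨M, hM⟩ : ∃ M : ℕ, ∀ z ∈ {z : X × X | η ≤ dist z.1 z.2},
      ∃ i : ℤ, i.natAbs < M ∧ δ < dist ((E ^ i) z.1) ((E ^ i) z.2) := by
    refine hK.induction_on (p := fun s => ∃ M : ℕ, ∀ z ∈ s,
      ∃ i : ℤ, i.natAbs < M ∧ δ < dist ((E ^ i) z.1) ((E ^ i) z.2)) ⟨0, by simp⟩ ?_ ?_ ?_
    · rintro s t hst ⟨M, hM⟩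
      exact ⟨M, fun z hz => hM z (hst hz)⟩
    · rintro s t ⟨M, hM⟩ ⟨M', hM'⟩
      refine ⟨M + M', ?_⟩
      rintro z (hz | hz)
      · obtain ⟨i, hi, h⟩ := hM z hz
        exact ⟨i, by omega, h⟩
      · obtain ⟨i, hi, h⟩ := hM' z hz
        exact ⟨i, by omega, h⟩
    · intro z hz
      obtain ⟨i, hi⟩ := hexp z.1 z.2 (dist_pos.1 (hη.trans_le hz))
      have hc : Continuous fun z : X × X => dist ((E ^ i) z.1) ((E ^ i) z.2) :=
        ((hE i).comp continuous_fst).dist ((hE i).comp continuous_snd)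
      exact ⟨_, mem_nhdsWithin_of_mem_nhds ((isOpen_lt continuous_const hc).mem_nhds hi),
        i.natAbs + 1, fun w hw => ⟨i, by omega, hw⟩⟩
  refine ⟨M + 1, by omega, fun x y h => ?_⟩
  by_contra! hlt
  obtain ⟨i, hi, h'⟩ := hM (x, y) hlt.le
  exact h'.not_ge (h i (by omega))

/-- A compact metric space has a finite coloring with color classes of small diameter. -/
theorem exists_finite_coloring (X : Type*) [MetricSpace X] [CompactSpace X] {δ : ℝ} (hδ : 0 < δ) :
    ∃ (p : ℕ) (c : X → Fin p), ∀ x y, c x = c y → dist x y ≤ δ := by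
  obtain ⟨t, -, ht, hcov⟩ := finite_cover_balls_of_compact (isCompact_univ (X := X)) (half_pos hδ)
  have := ht.fintype
  have hcov' : ∀ x : X, ∃ y : t, dist x y < δ / 2 := fun x => by
    obtain ⟨y, hy, hxy⟩ := mem_iUnion₂.1 (hcov (mem_univ x))
    exact ⟨⟨y, hy⟩, hxy⟩
  choose c hc using hcov'
  refine ⟨Fintype.card t, fun x => Fintype.equivFin t (c x), fun x y h => ?_⟩
  have h' : c x = c y := (Fintype.equivFin t).injective h
  have h1 := hc x
  have h2 := hc y
  rw [← h'] at h2
  have := dist_triangle_right x y (c x : X)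
  linarith

theorem exists_isAdaptedFiltration {X : Type*} [MetricSpace X] [CompactSpace X] {E : Equiv.Perm X}
    (hE : ∀ n : ℤ, Continuous (E ^ n)) {δ : ℝ} (hδ : 0 < δ)
    (hexp : ∀ x y : X, x ≠ y → ∃ n : ℤ, δ < dist ((E ^ n) x) ((E ^ n) y)) :
    ∃ U P, IsAdaptedFiltration E U P := by
  obtain ⟨M, hM1, hM⟩ := OrbitClose.exists_dist_le hE hexp (η := δ / 3) (by positivity)
  obtain ⟨p, c, hc⟩ := exists_finite_coloring X hδ
  refine ⟨fun n => OrbitClose E δ (M * n), (p : ℝ) ^ (2 * M), ?_⟩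
  have hthird : ∀ n x y, OrbitClose E δ (M * (n + 1)) x y → ∀ i : ℤ, i.natAbs < M * n →
      dist ((E ^ i) x) ((E ^ i) y) ≤ δ / 3 := fun n x y h i hi => by
    rw [mul_add, mul_one, add_comm] at h
    exact hM _ _ (h.shift hi.le)
  constructor
  · intro n x i _
    simpa using hδ.le
  · intro n x y h i hi
    rw [dist_comm]
    exact h i hi
  · intro m n x y hmn h i hi
    exact h i (hi.trans_le (Nat.mul_le_mul_left M hmn))
  · intro n a b c d hab hbc hcd i hi
    have h1 := hthird n _ _ hab i hi
    have h2 := hthird n _ _ hbc i hi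
    have h3 := hthird n _ _ hcd i hi
    have := dist_triangle4 ((E ^ i) a) ((E ^ i) b) ((E ^ i) c) ((E ^ i) d)
    linarith
  · intro x y h
    by_contra hne
    obtain ⟨i, hi⟩ := hexp x y hne
    exact hi.not_ge (h (i.natAbs + 1) i
      ((Nat.lt_succ_self _).trans_le (Nat.le_mul_of_pos_left _ hM1)))
  · intro n x
    have : ∀ i ∈ Finset.Icc (-(M * n : ℤ)) (M * n),
        ∀ᶠ y in 𝓝 x, dist ((E ^ i) x) ((E ^ i) y) < δ := fun i _ => by
      have hcont : Continuous fun y => dist ((E ^ i) x) ((E ^ i) y) := continuous_const.dist (hE i)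
      exact hcont.continuousAt.eventually_lt_const (by simpa using hδ)
    filter_upwards [(Filter.eventually_all_finset _).2 this] with y hy i hi
    refine (hy i ?_).le
    rw [Finset.mem_Icc]
    zify at hi
    exact abs_le.1 hi.le
  · intro i n s x y hi h
    rw [mul_add] at h
    exact h.shift (hi.trans (Nat.le_mul_of_pos_left s hM1))
  · positivity
  · intro n
    refine ⟨Fin (2 * (M * n)) → Fin p, inferInstance,
      fun x i => c ((E ^ ((i : ℤ) - (M * n : ℕ))) x), ?_, fun x y h i hi => ?_⟩
    · rw [Fintype.card_fun, Fintype.card_fin, Fintype.card_fin, ← pow_mul, ← mul_assoc]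
      push_cast
      exact le_rfl
    · have := congrFun h ⟨(i + (M * n : ℕ)).toNat, by omega⟩
      have hcast : (((i + (M * n : ℕ)).toNat : ℕ) : ℤ) - (M * n : ℕ) = i := by omega
      simp only [hcast] at this
      exact hc _ _ this

/-- The algebra of continuous functions whose oscillation at scale `n` is `O(2 ^ (-n))`. -/
def filtrationLipschitz {X : Type*} [TopologicalSpace X] [CompactSpace X]
    (U : ℕ → X → X → Prop) : Subalgebra ℝ C(X, ℝ) where
  carrier := {φ | ∃ L : ℝ, 0 ≤ L ∧ ∀ n x y, U n x y → |φ x - φ y| ≤ L * (1 / 2) ^ n}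
  algebraMap_mem' r := ⟨0, le_rfl, by simp⟩
  add_mem' := by
    rintro φ ψ ⟨L, hL, h⟩ ⟨L', hL', h'⟩
    refine ⟨L + L', by positivity, fun n x y hxy => ?_⟩
    have : (φ + ψ) x - (φ + ψ) y = (φ x - φ y) + (ψ x - ψ y) := by
      simp only [ContinuousMap.add_apply]
      ring
    rw [this, add_mul]
    exact (abs_add_le _ _).trans (add_le_add (h n x y hxy) (h' n x y hxy))
  mul_mem' := by
    rintro φ ψ ⟨L, hL, h⟩ ⟨L', hL', h'⟩
    refine ⟨‖φ‖ * L' + ‖ψ‖ * L, by positivity, fun n x y hxy => ?_⟩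
    have : (φ * ψ) x - (φ * ψ) y = φ x * (ψ x - ψ y) + ψ y * (φ x - φ y) := by
      simp only [ContinuousMap.mul_apply]
      ring
    rw [this, add_mul, mul_assoc, mul_assoc]
    refine (abs_add_le _ _).trans (add_le_add ?_ ?_)
    · rw [abs_mul]
      exact mul_le_mul (φ.norm_coe_le_norm x) (h' n x y hxy) (abs_nonneg _) (norm_nonneg _)
    · rw [abs_mul]
      exact mul_le_mul (ψ.norm_coe_le_norm y) (h n x y hxy) (abs_nonneg _) (norm_nonneg _)

theorem IsAdaptedFiltration.dense_filtrationLipschitz {X : Type*} [TopologicalSpace X]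
    [CompactSpace X] {E : Equiv.Perm X} {U : ℕ → X → X → Prop} {P : ℝ}
    (hU : IsAdaptedFiltration E U P) : Dense (filtrationLipschitz U : Set C(X, ℝ)) := by
  have h := ContinuousMap.subalgebra_topologicalClosure_eq_top_of_separatesPoints
    (filtrationLipschitz U) (by
      intro x y hxy
      obtain ⟨φ, hφ, hφ'⟩ := exists_separating_of_comp_subset U hU.refl hU.symm hU.anti hU.comp
        hU.sep hxy
      have hcont : Continuous φ := by
        refine continuous_iff_continuousAt.2 fun a => Metric.tendsto_nhds.2 fun ε hε => ?_
        obtain ⟨n, hn⟩ := exists_pow_lt_of_lt_one hε (one_half_lt_one (α := ℝ))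
        filter_upwards [hU.nhds n a] with b hb
        rw [dist_comm, Real.dist_eq]
        exact (hφ' n a b hb).trans_lt hn
      exact ⟨φ, ⟨⟨φ, hcont⟩, ⟨1, zero_le_one, by simpa using hφ'⟩, rfl⟩, hφ⟩)
  rw [dense_iff_closure_eq, ← Subalgebra.topologicalClosure_coe, h]
  rfl

theorem isOpen_setOf_forall_exists_zpow_ne {X : Type*} [TopologicalSpace X] [CompactSpace X]
    {E : Equiv.Perm X} (hE : ∀ n : ℤ, Continuous (E ^ n)) {C : Set (X × X)} (hC : IsCompact C) :
    IsOpen {h : C(X, ℝ) | ∀ z ∈ C, ∃ n : ℤ, h ((E ^ n) z.1) ≠ h ((E ^ n) z.2)} := by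
  refine isOpen_iff_mem_nhds.2 fun h hh => ?_
  refine hC.eventually_forall_of_forall_eventually
    (P := fun (h : C(X, ℝ)) (z : X × X) => ∃ n : ℤ, h ((E ^ n) z.1) ≠ h ((E ^ n) z.2))
    fun z hz => ?_
  obtain ⟨n, hn⟩ := hh z hz
  have h1 : Continuous fun w : C(X, ℝ) × X × X => w.1 ((E ^ n) w.2.1) :=
    continuous_fst.eval ((hE n).comp (continuous_fst.comp continuous_snd))
  have h2 : Continuous fun w : C(X, ℝ) × X × X => w.1 ((E ^ n) w.2.2) :=
    continuous_fst.eval ((hE n).comp (continuous_snd.comp continuous_snd))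
  filter_upwards [(isOpen_ne_fun h1 h2).mem_nhds hn] with w hw using ⟨n, hw⟩

/-- Generic functions separate orbits of nearby pairs as soon as sufficiently many delays are
in general position. -/
theorem IsAdaptedFiltration.exists_nhds_residual {X : Type*} [TopologicalSpace X]
    [CompactSpace X] {E : Equiv.Perm X} (hE : ∀ n : ℤ, Continuous (E ^ n))
    {U : ℕ → X → X → Prop} {P : ℝ} (hU : IsAdaptedFiltration E U P) {k : ℕ} (hk : P ^ 2 < 2 ^ k)
    (z₀ : X × X) (τ : Fin k → ℤ) (ψ : Fin k → C(X, ℝ))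
    (hψ : (Matrix.of fun j i => ψ i ((E ^ τ j) z₀.1) - ψ i ((E ^ τ j) z₀.2)).det ≠ 0) :
    ∃ C ∈ 𝓝 z₀, {h : C(X, ℝ) | ∀ z ∈ C, ∃ n : ℤ, h ((E ^ n) z.1) ≠ h ((E ^ n) z.2)} ∈
      residual C(X, ℝ) := by
  obtain ⟨φ, hφ, hφ𝒜⟩ : ∃ φ : Fin k → C(X, ℝ),
      (Matrix.of fun j i => φ i ((E ^ τ j) z₀.1) - φ i ((E ^ τ j) z₀.2)).det ≠ 0 ∧
        ∀ i, φ i ∈ filtrationLipschitz U := by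
    have hcont : Continuous fun φ : Fin k → C(X, ℝ) =>
        (Matrix.of fun j i => φ i ((E ^ τ j) z₀.1) - φ i ((E ^ τ j) z₀.2)).det := by
      refine Continuous.matrix_det (continuous_matrix fun j i => ?_)
      exact ((continuous_eval_const _).comp (continuous_apply i)).sub
        ((continuous_eval_const _).comp (continuous_apply i))
    obtain ⟨φ, h1, h2⟩ := (dense_pi (Set.univ : Set (Fin k)) fun i _ =>
      hU.dense_filtrationLipschitz).exists_mem_open (isOpen_ne_fun hcont continuous_const) ⟨ψ, hψ⟩
    exact ⟨φ, h2, fun i => h1 i (Set.mem_univ i)⟩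
  let A : X × X → Matrix (Fin k) (Fin k) ℝ := fun z =>
    Matrix.of fun j i => φ i ((E ^ τ j) z.1) - φ i ((E ^ τ j) z.2)
  have hAcont : Continuous fun z => |(A z).det| := by
    refine (Continuous.matrix_det (continuous_matrix fun j i => ?_)).abs
    exact ((φ i).continuous.comp ((hE _).comp continuous_fst)).sub
      ((φ i).continuous.comp ((hE _).comp continuous_snd))
  have hdet : 0 < |(A z₀).det| := abs_pos.2 hφ
  let C : Set (X × X) := {z | |(A z₀).det| / 2 ≤ |(A z).det|}
  have hCclosed : IsClosed C := isClosed_le continuous_const hAcont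
  refine ⟨C, ?_, residual_of_dense_open
    (isOpen_setOf_forall_exists_zpow_ne hE hCclosed.isCompact) ?_⟩
  · filter_upwards [hAcont.continuousAt.eventually_const_lt (half_lt_self hdet)] with z hz
      using hz.le
  refine dense_closure.1 (hU.dense_filtrationLipschitz.mono fun f hf => ?_)
  refine Metric.mem_closure_iff.2 fun ε hε => ?_
  obtain ⟨Lf, hLf, hf⟩ := hf
  choose L hL hφL using hφ𝒜
  let S := ∑ i, ‖φ i‖
  have hS : 0 ≤ S := Finset.sum_nonneg fun i _ => norm_nonneg _
  let s : ℕ := ∑ j, (τ j).natAbs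
  have hs : ∀ j, (τ j).natAbs ≤ s := fun j =>
    Finset.single_le_sum (f := fun j => (τ j).natAbs) (fun _ _ => Nat.zero_le _)
      (Finset.mem_univ j)
  have hL' : ∀ i, L i ≤ Lf + ∑ i, L i := fun i =>
    (Finset.single_le_sum (fun i _ => hL i) (Finset.mem_univ i)).trans (by linarith)
  have hLf' : Lf ≤ Lf + ∑ i, L i :=
    le_add_of_nonneg_right (Finset.sum_nonneg fun i _ => hL i)
  have hdiff : ∀ (g : C(X, ℝ)) (K : ℝ),
      (∀ n x y, U n x y → |g x - g y| ≤ K * (1 / 2) ^ n) → K ≤ Lf + ∑ i, L i →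
      ∀ (n : ℕ) (z z' : X × X), U (n + s) z.1 z'.1 → U (n + s) z.2 z'.2 → ∀ j,
        |(g ((E ^ τ j) z.1) - g ((E ^ τ j) z.2)) - (g ((E ^ τ j) z'.1) - g ((E ^ τ j) z'.2))| ≤
          2 * (Lf + ∑ i, L i) * (1 / 2) ^ n := by
    intro g K hg hK n z z' h1 h2 j
    have h1' := hg _ _ _ (hU.shift (τ j) n s _ _ (hs j) h1)
    have h2' := hg _ _ _ (hU.shift (τ j) n s _ _ (hs j) h2)
    have h3 : K * (1 / 2) ^ n ≤ (Lf + ∑ i, L i) * (1 / 2) ^ n := by gcongr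
    rw [abs_le] at h1' h2' ⊢
    constructor <;> linarith
  obtain ⟨v, hv, hv0⟩ := exists_small_forall_add_mulVec_ne_zero (Z := C)
    (fun z j => f ((E ^ τ j) z.1.1) - f ((E ^ τ j) z.1.2)) (fun z => A z.1)
    (C := (P ^ 2) ^ s) (R := P ^ 2) (L := 2 * (Lf + ∑ i, L i)) (η := ε / (2 * (1 + S)))
    (half_pos hdet) (fun z => z.2) (by positivity) hk
    (mul_nonneg zero_le_two (hLf.trans hLf'))
    (fun n => by
      obtain ⟨Q, _, code, hcard, hcode⟩ := hU.code (n + s)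
      refine ⟨Q × Q, inferInstance, fun z => (code z.1.1, code z.1.2), ?_, fun z z' h => ?_⟩
      · rw [Fintype.card_prod, Nat.cast_mul]
        calc (Fintype.card Q : ℝ) * Fintype.card Q ≤ P ^ (n + s) * P ^ (n + s) := by
              have := hU.nonneg
              gcongr
          _ = _ := by ring
      · obtain ⟨h1, h2⟩ := Prod.mk.inj h
        exact ⟨hdiff ⟨f, f.continuous⟩ Lf hf hLf' n z z' (hcode _ _ h1) (hcode _ _ h2), fun j i =>
          hdiff (φ i) (L i) (hφL i) (hL' i) n z z' (hcode _ _ h1) (hcode _ _ h2) j⟩)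
    (by positivity)
  refine ⟨f + ∑ i, v i • φ i, fun z hz => ?_, ?_⟩
  · by_contra! hcon
    refine hv0 ⟨z, hz⟩ (funext fun j => ?_)
    have h := hcon (τ j)
    simp only [ContinuousMap.add_apply, ContinuousMap.coe_sum, Finset.sum_apply,
      ContinuousMap.smul_apply, smul_eq_mul] at h
    have h' : (A z).mulVec v j =
        ∑ i, v i * φ i ((E ^ τ j) z.1) - ∑ i, v i * φ i ((E ^ τ j) z.2) := by
      rw [← Finset.sum_sub_distrib, Matrix.mulVec, dotProduct]
      refine Finset.sum_congr rfl fun i _ => ?_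
      change (φ i _ - φ i _) * v i = _
      ring
    simp only [Pi.add_apply, Pi.zero_apply, h']
    linarith
  · rw [dist_self_add_right]
    calc ‖∑ i, v i • φ i‖ ≤ ∑ i, ε / (2 * (1 + S)) * ‖φ i‖ :=
          norm_sum_le_of_le _ fun i _ => by
            rw [norm_smul]
            exact mul_le_mul_of_nonneg_right (hv i) (norm_nonneg _)
      _ = ε / (2 * (1 + S)) * S := by rw [← Finset.mul_sum]
      _ < ε := by
          rw [div_mul_eq_mul_div, div_lt_iff₀ (by positivity)]
          nlinarith

/-- A point with infinite orbit and any other point admit arbitrarily many delays in general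
position. -/
theorem exists_delays_of_injective {X : Type*} {E : Equiv.Perm X} {x y : X} (hxy : x ≠ y)
    (hx : Injective fun n : ℤ => (E ^ n) x) (k : ℕ) :
    ∃ τ : Fin k → ℤ, Injective (fun j => (E ^ τ j) x) ∧ ∀ i j, (E ^ τ i) x ≠ (E ^ τ j) y := by
  by_cases h : ∃ s : ℤ, (E ^ s) x = y
  · obtain ⟨s, rfl⟩ := h
    have hs : s ≠ 0 := by
      rintro rfl
      simp at hxy
    refine ⟨fun j => 2 * s * (j : ℕ), hx.comp fun i j hij => ?_, fun i j hij => ?_⟩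
    · simpa [hs, Fin.ext_iff] using hij
    · rw [← Equiv.Perm.mul_apply, ← zpow_add] at hij
      have h1 : s * (2 * (i : ℕ) : ℤ) = s * (2 * (j : ℕ) + 1 : ℤ) := by linarith [hx hij]
      have := mul_left_cancel₀ hs h1
      omega
  · push Not at h
    refine ⟨fun j => (j : ℕ), hx.comp fun i j hij => by simpa [Fin.ext_iff] using hij,
      fun i j hij => h (-(j : ℕ) + (i : ℕ)) ?_⟩
    rw [zpow_add, Equiv.Perm.mul_apply, hij, ← Equiv.Perm.mul_apply, ← zpow_add]
    simp

theorem exists_delay_matrix_det_ne_zero {X : Type*} [TopologicalSpace X] [NormalSpace X]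
    [T1Space X] {E : Equiv.Perm X} {x y : X} (hxy : x ≠ y)
    (hx : Injective fun n : ℤ => (E ^ n) x) (k : ℕ) :
    ∃ (τ : Fin k → ℤ) (ψ : Fin k → C(X, ℝ)),
      (Matrix.of fun j i => ψ i ((E ^ τ j) x) - ψ i ((E ^ τ j) y)).det ≠ 0 := by
  obtain ⟨τ, hinj, hne⟩ := exists_delays_of_injective hxy hx k
  have hψ : ∀ i, ∃ ψ : C(X, ℝ), ψ ((E ^ τ i) x) = 1 ∧ (∀ j, j ≠ i → ψ ((E ^ τ j) x) = 0) ∧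
      ∀ j, ψ ((E ^ τ j) y) = 0 := by
    intro i
    let s : Set X := (fun j => (E ^ τ j) x) '' {j | j ≠ i} ∪ range fun j => (E ^ τ j) y
    have hs : s.Finite := (Set.toFinite _).union (Set.finite_range _)
    obtain ⟨ψ, h0, h1, -⟩ := exists_continuous_zero_one_of_isClosed hs.isClosed
      (isClosed_singleton (x := (E ^ τ i) x)) (by
        rw [Set.disjoint_singleton_right]
        rintro (⟨j, hj, h⟩ | ⟨j, h⟩)
        · exact hj (hinj h)
        · exact hne i j h.symm)
    exact ⟨ψ, h1 rfl, fun j hj => h0 (Or.inl ⟨j, hj, rfl⟩), fun j => h0 (Or.inr ⟨j, rfl⟩)⟩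
  choose ψ h1 h0 h0' using hψ
  refine ⟨τ, ψ, ?_⟩
  have : (Matrix.of fun j i => ψ i ((E ^ τ j) x) - ψ i ((E ^ τ j) y)) = 1 := by
    ext j i
    by_cases hji : j = i
    · subst hji
      simp [h1, h0']
    · simp [h0 i j hji, h0', Matrix.one_apply_ne hji]
  simp [this]

theorem exists_zpow_apply_eq_self_of_not_injective {X : Type*} {E : Equiv.Perm X} {x : X}
    (hx : ¬ Injective fun n : ℤ => (E ^ n) x) : ∃ n : ℕ, 0 < n ∧ (E ^ n) x = x := by
  have key : ∀ a b : ℤ, a < b → (E ^ a) x = (E ^ b) x → ∃ n : ℕ, 0 < n ∧ (E ^ n) x = x := by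
    intro a b hab h
    refine ⟨(b - a).toNat, by omega, ?_⟩
    rw [← zpow_natCast, Int.toNat_of_nonneg (by omega), sub_eq_neg_add, zpow_add,
      Equiv.Perm.mul_apply, ← h, ← Equiv.Perm.mul_apply, ← zpow_add]
    simp
  simp only [Injective, not_forall] at hx
  obtain ⟨a, b, h, hne⟩ := hx
  rcases lt_or_gt_of_ne hne with hlt | hlt
  · exact key a b hlt h
  · exact key b a hlt h.symm

theorem countable_setOf_not_injective_zpow {X : Type*} [MetricSpace X] [CompactSpace X]
    {E : Equiv.Perm X} {δ : ℝ} (hδ : 0 < δ)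
    (hexp : ∀ x y : X, x ≠ y → ∃ n : ℤ, δ < dist ((E ^ n) x) ((E ^ n) y)) :
    {x : X | ¬ Injective fun n : ℤ => (E ^ n) x}.Countable := by
  obtain ⟨p, c, hc⟩ := exists_finite_coloring X hδ
  have hfin : ∀ n : ℕ, 0 < n → {x : X | (E ^ n) x = x}.Finite := by
    intro n hn
    refine Set.Finite.of_injOn (f := fun x (i : Fin n) => c ((E ^ (i : ℕ)) x))
      (t := Set.univ) (fun _ _ => Set.mem_univ _) ?_ Set.finite_univ
    intro x hx y hy h
    by_contra hne
    obtain ⟨i, hi⟩ := hexp x y hne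
    have hn' : (n : ℤ) ≠ 0 := by omega
    have hmod : ∀ w : X, (E ^ n) w = w → (E ^ i) w = (E ^ (i % n).toNat) w := by
      intro w hw
      have hw' : (E ^ (n * (i / n) : ℤ)) w = w := by
        rw [zpow_mul, zpow_natCast]
        exact Equiv.Perm.zpow_apply_eq_self_of_apply_eq_self hw _
      conv_lhs => rw [← Int.emod_add_mul_ediv i n, zpow_add, Equiv.Perm.mul_apply, hw']
      rw [← zpow_natCast, Int.toNat_of_nonneg (Int.emod_nonneg _ hn')]
    rw [hmod x hx, hmod y hy] at hi
    have hlt : (i % n).toNat < n := by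
      have := Int.emod_lt_of_pos i (b := n) (by omega)
      have := Int.emod_nonneg i hn'
      omega
    exact hi.not_ge (hc _ _ (congrFun h ⟨_, hlt⟩))
  refine (Set.countable_iUnion fun n : ℕ => Set.countable_iUnion fun hn : 0 < n =>
    (hfin n hn).countable).mono fun x hx => ?_
  obtain ⟨n, hn, h⟩ := exists_zpow_apply_eq_self_of_not_injective hx
  exact Set.mem_iUnion₂.2 ⟨n, hn, h⟩

/-- A generic continuous function separates two given points. -/
theorem residual_setOf_apply_ne {X : Type*} [TopologicalSpace X] [NormalSpace X] [T1Space X]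
    [CompactSpace X] {x y : X} (hxy : x ≠ y) :
    {h : C(X, ℝ) | h x ≠ h y} ∈ residual C(X, ℝ) := by
  obtain ⟨u, hu0, hu1, -⟩ := exists_continuous_zero_one_of_isClosed
    (isClosed_singleton (x := y)) (isClosed_singleton (x := x)) (by simpa using hxy.symm)
  have hux : u x = 1 := hu1 rfl
  have huy : u y = 0 := hu0 rfl
  let ℓ : C(X, ℝ) →L[ℝ] ℝ := ContinuousMap.evalCLM ℝ x - ContinuousMap.evalCLM ℝ y
  have hsurj : Surjective ℓ := fun r => ⟨r • u, by simp [ℓ, hux, huy]⟩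
  have hres : ({0}ᶜ : Set ℝ) ∈ residual ℝ :=
    residual_of_dense_open isOpen_compl_singleton (dense_compl_singleton 0)
  filter_upwards [tendsto_residual_of_isOpenMap ℓ.continuous (ℓ.isOpenMap hsurj) hres] with h hh heq
  exact hh (sub_eq_zero.2 heq)

/-- For an expansive system, a generic real observable separates all orbits. -/
theorem residual_setOf_forall_exists_zpow_ne {X : Type*} [MetricSpace X] [CompactSpace X]
    {E : Equiv.Perm X} (hE : ∀ n : ℤ, Continuous (E ^ n)) {δ : ℝ} (hδ : 0 < δ)
    (hexp : ∀ x y : X, x ≠ y → ∃ n : ℤ, δ < dist ((E ^ n) x) ((E ^ n) y)) :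
    {h : C(X, ℝ) | ∀ x y : X, x ≠ y → ∃ n : ℤ, h ((E ^ n) x) ≠ h ((E ^ n) y)} ∈
      residual C(X, ℝ) := by
  obtain ⟨U, P, hU⟩ := exists_isAdaptedFiltration hE hδ hexp
  obtain ⟨k, hk⟩ := pow_unbounded_of_one_lt (P ^ 2) (one_lt_two (α := ℝ))
  have hlocal : ∀ z ∈ {z : X × X | z.1 ≠ z.2}, ((Injective fun n : ℤ => (E ^ n) z.1) ∨
      Injective fun n : ℤ => (E ^ n) z.2) → ∃ C ∈ 𝓝 z, {h : C(X, ℝ) | ∀ z ∈ C,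
        ∃ n : ℤ, h ((E ^ n) z.1) ≠ h ((E ^ n) z.2)} ∈ residual C(X, ℝ) := by
    rintro z hz (hinj | hinj)
    · obtain ⟨τ, ψ, hψ⟩ := exists_delay_matrix_det_ne_zero hz hinj k
      exact hU.exists_nhds_residual hE hk z τ ψ hψ
    · obtain ⟨τ, ψ, hψ⟩ := exists_delay_matrix_det_ne_zero hz.symm hinj k
      refine hU.exists_nhds_residual hE hk z τ ψ ?_
      have : (Matrix.of fun j i => ψ i ((E ^ τ j) z.1) - ψ i ((E ^ τ j) z.2)) =
          -Matrix.of fun j i => ψ i ((E ^ τ j) z.2) - ψ i ((E ^ τ j) z.1) := by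
        ext j i
        simp
      rw [this, Matrix.det_neg]
      exact mul_ne_zero (by simp) hψ
  let Pd : Set X := {x : X | ¬ Injective fun n : ℤ => (E ^ n) x}
  have hPd : (Pd ×ˢ Pd).Countable :=
    (countable_setOf_not_injective_zpow hδ hexp).prod (countable_setOf_not_injective_zpow hδ hexp)
  have hW : ∀ z : X × X, z ∈ {z : X × X | z.1 ≠ z.2} \ Pd ×ˢ Pd → ∃ C ∈ 𝓝 z,
      {h : C(X, ℝ) | ∀ z ∈ C, ∃ n : ℤ, h ((E ^ n) z.1) ≠ h ((E ^ n) z.2)} ∈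
        residual C(X, ℝ) := by
    rintro z ⟨hz, hz'⟩
    refine hlocal z hz ?_
    by_contra! hcon
    exact hz' hcon
  choose! C hCn hCr using hW
  obtain ⟨t, hts, htc, hcov⟩ := TopologicalSpace.countable_cover_nhdsWithin
    fun z hz => mem_nhdsWithin_of_mem_nhds (hCn z hz)
  have h1 := (countable_bInter_mem htc).2 fun z hz => hCr z (hts hz)
  have h2 := (countable_bInter_mem (hPd.mono (inter_subset_left (t := {z | z.1 ≠ z.2})))).2
    fun z hz => residual_setOf_apply_ne hz.2
  filter_upwards [h1, h2] with h hh1 hh2 x y hxy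
  by_cases hP : (x, y) ∈ Pd ×ˢ Pd
  · exact ⟨0, mem_iInter₂.1 hh2 (x, y) ⟨hP, hxy⟩⟩
  · obtain ⟨z, hz, hzC⟩ := mem_iUnion₂.1 (hcov ⟨hxy, hP⟩)
    exact mem_iInter₂.1 hh1 z hz (x, y) hzC

/-- For an expansive system, separation of orbits by a continuous function is automatically
uniform. -/
theorem exists_pos_forall_exists_lt_norm_sub {X F : Type*} [MetricSpace X] [CompactSpace X]
    [NormedAddCommGroup F] {E : Equiv.Perm X} (hE : ∀ n : ℤ, Continuous (E ^ n)) {δ : ℝ}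
    (hδ : 0 < δ) (hexp : ∀ x y : X, x ≠ y → ∃ n : ℤ, δ < dist ((E ^ n) x) ((E ^ n) y))
    (f : C(X, F)) (hf : ∀ x y : X, x ≠ y → ∃ n : ℤ, f ((E ^ n) x) ≠ f ((E ^ n) y)) :
    ∃ ε : ℝ, 0 < ε ∧ ∀ x y : X, x ≠ y → ∃ n : ℤ, ε < ‖f ((E ^ n) x) - f ((E ^ n) y)‖ := by
  have hK : IsCompact {z : X × X | δ ≤ dist z.1 z.2} :=
    (isClosed_le continuous_const (by fun_prop)).isCompact
  obtain ⟨ε, hε, h⟩ : ∃ ε : ℝ, 0 < ε ∧ ∀ z ∈ {z : X × X | δ ≤ dist z.1 z.2},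
      ∃ n : ℤ, ε < ‖f ((E ^ n) z.1) - f ((E ^ n) z.2)‖ := by
    refine hK.induction_on (p := fun s => ∃ ε : ℝ, 0 < ε ∧ ∀ z ∈ s,
      ∃ n : ℤ, ε < ‖f ((E ^ n) z.1) - f ((E ^ n) z.2)‖) ⟨1, one_pos, by simp⟩ ?_ ?_ ?_
    · rintro s t hst ⟨ε, hε, h⟩
      exact ⟨ε, hε, fun z hz => h z (hst hz)⟩
    · rintro s t ⟨ε, hε, h⟩ ⟨ε', hε', h'⟩
      refine ⟨min ε ε', lt_min hε hε', ?_⟩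
      rintro z (hz | hz)
      · exact (h z hz).imp fun n hn => (min_le_left _ _).trans_lt hn
      · exact (h' z hz).imp fun n hn => (min_le_right _ _).trans_lt hn
    · intro z hz
      obtain ⟨n, hn⟩ := hf z.1 z.2 (dist_pos.1 (hδ.trans_le hz))
      have hpos := norm_pos_iff.2 (sub_ne_zero.2 hn)
      have hc : Continuous fun z : X × X => ‖f ((E ^ n) z.1) - f ((E ^ n) z.2)‖ :=
        ((f.continuous.comp ((hE n).comp continuous_fst)).sub
          (f.continuous.comp ((hE n).comp continuous_snd))).norm
      exact ⟨_, mem_nhdsWithin_of_mem_nhds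
        ((isOpen_lt continuous_const hc).mem_nhds (half_lt_self hpos)), _, half_pos hpos,
        fun w hw => ⟨n, hw⟩⟩
  refine ⟨ε, hε, fun x y hxy => ?_⟩
  obtain ⟨m, hm⟩ := hexp x y hxy
  obtain ⟨n, hn⟩ := h ((E ^ m) x, (E ^ m) y) hm.le
  exact ⟨n + m, by rwa [zpow_add]⟩

theorem exists_expansive_const_of_observable {X F : Type*} [MetricSpace X] [CompactSpace X]
    [NormedAddCommGroup F] {E : Equiv.Perm X} (f : C(X, F)) {ε : ℝ} (hε : 0 < ε)
    (hf : ∀ x y : X, x ≠ y → ∃ n : ℤ, ε < ‖f ((E ^ n) x) - f ((E ^ n) y)‖) :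
    ∃ δ : ℝ, 0 < δ ∧ ∀ x y : X, x ≠ y → ∃ n : ℤ, δ < dist ((E ^ n) x) ((E ^ n) y) := by
  obtain ⟨δ, hδ, h⟩ := Metric.uniformContinuous_iff.1
    (CompactSpace.uniformContinuous_of_continuous f.continuous) ε hε
  refine ⟨δ / 2, half_pos hδ, fun x y hxy => (hf x y hxy).imp fun n hn => ?_⟩
  by_contra! hle
  have := h (hle.trans_lt (half_lt_self hδ))
  rw [dist_eq_norm] at this
  linarith

theorem Homeomorph.continuous_toEquiv_zpow {X : Type*} [TopologicalSpace X] (T : X ≃ₜ X) (n : ℤ) :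
    Continuous ((T.toEquiv : Equiv.Perm X) ^ n) := by
  have hT : ∀ n : ℕ, Continuous ((T.toEquiv : Equiv.Perm X) ^ n) := fun n => by
    rw [Equiv.Perm.coe_pow]
    exact T.continuous.iterate n
  have hT' : ∀ n : ℕ, Continuous ((T.toEquiv : Equiv.Perm X)⁻¹ ^ n) := fun n => by
    rw [Equiv.Perm.coe_pow]
    exact T.symm.continuous.iterate n
  cases n with
  | ofNat n => simpa using hT n
  | negSucc n => simpa only [zpow_negSucc, ← inv_pow] using hT' (n + 1)

/-- A generic vector-valued map has a first coordinate with any given generic property. -/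
theorem residual_setOf_coord_comp_mem {X : Type*} [TopologicalSpace X] [CompactSpace X] {m : ℕ}
    (i : Fin m) {s : Set C(X, ℝ)} (hs : s ∈ residual C(X, ℝ)) :
    {f : C(X, EuclideanSpace ℝ (Fin m)) |
      (EuclideanSpace.proj (𝕜 := ℝ) i : EuclideanSpace ℝ (Fin m) →L[ℝ] ℝ).compLeftContinuous ℝ X f
        ∈ s} ∈ residual C(X, EuclideanSpace ℝ (Fin m)) := by
  let ℓ := (EuclideanSpace.proj (𝕜 := ℝ) i : EuclideanSpace ℝ (Fin m) →L[ℝ] ℝ).compLeftContinuous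
    ℝ X
  have hsurj : Surjective ℓ := fun h => by
    refine ⟨((ContinuousLinearMap.toSpanSingleton ℝ
      (EuclideanSpace.single i (1 : ℝ))).compLeftContinuous ℝ X) h, ?_⟩
    ext x
    change (h x • EuclideanSpace.single i (1 : ℝ)) i = h x
    simp
  exact tendsto_residual_of_isOpenMap ℓ.continuous (ℓ.isOpenMap hsurj) hs

/-- For a homeomorphism `T` of a compact metric space `X` and `m ≥ 1`, the following are
equivalent: (1) `T` is expansive; (2) a residual set of `f ∈ C(X, ℝ^m)` strictly
bilaterally observes `T`; (3) some `f ∈ C(X, ℝ^m)` strictly bilaterally observes `T`. -/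
theorem stmt12 {X : Type*} [MetricSpace X] [CompactSpace X]
    (T : X ≃ₜ X) (m : ℕ) (hm : 1 ≤ m) :
    ((∃ δ : ℝ, 0 < δ ∧ ∀ x y : X, x ≠ y →
        ∃ n : ℤ, δ < dist ((T.toEquiv ^ n) x) ((T.toEquiv ^ n) y)) ↔
      {f : C(X, EuclideanSpace ℝ (Fin m)) |
          ∃ ε : ℝ, 0 < ε ∧ ∀ x y : X, x ≠ y →
            ∃ n : ℤ, ε < ‖f ((T.toEquiv ^ n) x) - f ((T.toEquiv ^ n) y)‖} ∈
        residual C(X, EuclideanSpace ℝ (Fin m))) ∧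
    ({f : C(X, EuclideanSpace ℝ (Fin m)) |
          ∃ ε : ℝ, 0 < ε ∧ ∀ x y : X, x ≠ y →
            ∃ n : ℤ, ε < ‖f ((T.toEquiv ^ n) x) - f ((T.toEquiv ^ n) y)‖} ∈
        residual C(X, EuclideanSpace ℝ (Fin m)) ↔
      ∃ f : C(X, EuclideanSpace ℝ (Fin m)),
        ∃ ε : ℝ, 0 < ε ∧ ∀ x y : X, x ≠ y →
          ∃ n : ℤ, ε < ‖f ((T.toEquiv ^ n) x) - f ((T.toEquiv ^ n) y)‖) := by
  have h12 : (∃ δ : ℝ, 0 < δ ∧ ∀ x y : X, x ≠ y →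
        ∃ n : ℤ, δ < dist ((T.toEquiv ^ n) x) ((T.toEquiv ^ n) y)) →
      {f : C(X, EuclideanSpace ℝ (Fin m)) |
          ∃ ε : ℝ, 0 < ε ∧ ∀ x y : X, x ≠ y →
            ∃ n : ℤ, ε < ‖f ((T.toEquiv ^ n) x) - f ((T.toEquiv ^ n) y)‖} ∈
        residual C(X, EuclideanSpace ℝ (Fin m)) := by
    rintro ⟨δ, hδ, hexp⟩
    have hE := T.continuous_toEquiv_zpow
    filter_upwards [residual_setOf_coord_comp_mem ⟨0, hm⟩
      (residual_setOf_forall_exists_zpow_ne hE hδ hexp)] with f hf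
    refine exists_pos_forall_exists_lt_norm_sub hE hδ hexp f fun x y hxy => ?_
    obtain ⟨n, hn⟩ := hf x y hxy
    exact ⟨n, fun h => hn (congrArg (fun v : EuclideanSpace ℝ (Fin m) => v ⟨0, hm⟩) h)⟩
  have h23 : {f : C(X, EuclideanSpace ℝ (Fin m)) |
          ∃ ε : ℝ, 0 < ε ∧ ∀ x y : X, x ≠ y →
            ∃ n : ℤ, ε < ‖f ((T.toEquiv ^ n) x) - f ((T.toEquiv ^ n) y)‖} ∈
        residual C(X, EuclideanSpace ℝ (Fin m)) →
      ∃ f : C(X, EuclideanSpace ℝ (Fin m)),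
        ∃ ε : ℝ, 0 < ε ∧ ∀ x y : X, x ≠ y →
          ∃ n : ℤ, ε < ‖f ((T.toEquiv ^ n) x) - f ((T.toEquiv ^ n) y)‖ :=
    fun h => (dense_of_mem_residual h).nonempty
  have h31 : (∃ f : C(X, EuclideanSpace ℝ (Fin m)),
        ∃ ε : ℝ, 0 < ε ∧ ∀ x y : X, x ≠ y →
          ∃ n : ℤ, ε < ‖f ((T.toEquiv ^ n) x) - f ((T.toEquiv ^ n) y)‖) →
      ∃ δ : ℝ, 0 < δ ∧ ∀ x y : X, x ≠ y →
        ∃ n : ℤ, δ < dist ((T.toEquiv ^ n) x) ((T.toEquiv ^ n) y) := by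
    rintro ⟨f, ε, hε, hf⟩
    exact exists_expansive_const_of_observable f hε hf
  exact ⟨⟨h12, fun h => h31 (h23 h)⟩, ⟨h23, fun h => h12 (h31 h)⟩⟩
end
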